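/- arXiv:1510.03788 — 11 statements merged into one kernel-verified Lean document; each statement's English description precedes it below -/
import Mathlib

section
/- Let ⟨𝒰⟩ be a nonempty canonical open set of S_c(X), i.e. the trace on S_c(X) of a basic Vietoris open set determined by a finite family 𝒰 of pairwise disjoint nonempty open subsets of X. Then the union of all members of ⟨𝒰⟩ equals the union of the family 𝒰. Moreover, for every nonempty open subset O of S_c(X), the set ⋃O (the union in X of all sequences belonging to O) is open in X. -/
open Set Topology

/-- The Vietoris topology on the powerset of a topological space, generated by the
standard subbasis.  Restricting it to any family of closed subsets yields the usual
Vietoris hyperspace topology on that family. -/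
def vietorisTopology (X : Type*) [TopologicalSpace X] : TopologicalSpace (Set X) :=
  TopologicalSpace.generateFrom
    {A | (∃ U : Set X, IsOpen U ∧ A = {F : Set X | F ⊆ U}) ∨
         (∃ U : Set X, IsOpen U ∧ A = {F : Set X | (F ∩ U).Nonempty})}

/-- `S` is a nontrivial convergent sequence with limit point `x`:  `S` is countably
infinite, closed, `x` is its unique non-isolated point, and `S \ U` is finite for
every open neighbourhood `U` of `x`. -/
def IsNCS {X : Type*} [TopologicalSpace X] (S : Set X) (x : X) : Prop :=
  S.Infinite ∧ S.Countable ∧ IsClosed S ∧ x ∈ S ∧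
    (¬ ∃ U : Set X, IsOpen U ∧ U ∩ S = {x}) ∧
    (∀ y ∈ S, y ≠ x → ∃ U : Set X, IsOpen U ∧ U ∩ S = {y}) ∧
    (∀ U : Set X, IsOpen U → x ∈ U → (S \ U).Finite)

/-- The hyperspace `S_c(X)` of all nontrivial convergent sequences of `X`. -/
def Sc (X : Type*) [TopologicalSpace X] : Type _ :=
  {S : Set X // ∃ x, IsNCS S x}

/-- `S_c(X)` carries the relative Vietoris topology. -/
instance (X : Type*) [TopologicalSpace X] : TopologicalSpace (Sc X) :=
  TopologicalSpace.induced (fun S => S.1) (vietorisTopology X)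

theorem IsNCS.insert_pt {X : Type*} [TopologicalSpace X] [T1Space X] {S : Set X} {x : X}
    (h : IsNCS S x) (p : X) : IsNCS (insert p S) x := by
  by_cases hp : p ∈ S
  · rwa [Set.insert_eq_of_mem hp]
  obtain ⟨h1, h2, h3, h4, h5, h6, h7⟩ := h
  refine ⟨h1.mono (Set.subset_insert _ _), h2.insert p, ?_, Or.inr h4, ?_, ?_, ?_⟩
  · rw [Set.insert_eq]
    exact isClosed_singleton.union h3
  · rintro ⟨U, hU, hUS⟩
    refine h5 ⟨U, hU, ?_⟩
    have hx : x ∈ U ∩ insert p S := by rw [hUS]; rfl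
    apply Set.Subset.antisymm
    · intro y hy
      rw [← hUS]
      exact ⟨hy.1, Or.inr hy.2⟩
    · rintro y rfl
      exact ⟨hx.1, h4⟩
  · rintro y (rfl | hy) hyx
    · refine ⟨Sᶜ, h3.isOpen_compl, ?_⟩
      ext z
      simp only [Set.mem_inter_iff, Set.mem_compl_iff, Set.mem_insert_iff, Set.mem_singleton_iff]
      constructor
      · tauto
      · rintro rfl
        exact ⟨hp, Or.inl rfl⟩
    · obtain ⟨U, hU, hUS⟩ := h6 y hy hyx
      refine ⟨U ∩ {p}ᶜ, hU.inter isClosed_singleton.isOpen_compl, ?_⟩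
      rw [← hUS]
      ext z
      simp only [Set.mem_inter_iff, Set.mem_compl_iff, Set.mem_insert_iff, Set.mem_singleton_iff]
      constructor
      · tauto
      · rintro ⟨hz, hzS⟩
        refine ⟨⟨hz, ?_⟩, Or.inr hzS⟩
        rintro rfl
        exact hp hzS
  · intro U hU hx
    refine ((h7 U hU hx).insert p).subset ?_
    rintro z ⟨rfl | hz, hzU⟩
    · exact Or.inl rfl
    · exact Or.inr ⟨hz, hzU⟩

theorem vietoris_insert {X : Type*} [TopologicalSpace X] {A : Set (Set X)}
    (hA : IsOpen[vietorisTopology X] A) : ∀ S ∈ A,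
    ∃ W : Set X, IsOpen W ∧ S ⊆ W ∧ ∀ q ∈ W, insert q S ∈ A := by
  have hA' : TopologicalSpace.GenerateOpen _ A := hA
  clear hA
  induction hA' with
  | basic A h =>
    intro S hS
    rcases h with ⟨U, hU, rfl⟩ | ⟨U, hU, rfl⟩
    · exact ⟨U, hU, hS, fun q hq => Set.insert_subset hq hS⟩
    · exact ⟨Set.univ, isOpen_univ, Set.subset_univ _, fun q _ =>
        Set.Nonempty.mono (Set.inter_subset_inter_left _ (Set.subset_insert _ _)) hS⟩
  | univ => exact fun S _ => ⟨Set.univ, isOpen_univ, Set.subset_univ _, fun _ _ => trivial⟩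
  | inter A B _ _ iA iB =>
    intro S hS
    obtain ⟨W, hW, hSW, h⟩ := iA S hS.1
    obtain ⟨V, hV, hSV, h'⟩ := iB S hS.2
    exact ⟨W ∩ V, hW.inter hV, Set.subset_inter hSW hSV, fun q hq => ⟨h q hq.1, h' q hq.2⟩⟩
  | sUnion C _ ih =>
    rintro S ⟨A, hA, hS⟩
    obtain ⟨W, hW, hSW, h⟩ := ih A hA S hS
    exact ⟨W, hW, hSW, fun q hq => ⟨A, hA, h q hq⟩⟩

/-- Lemma (canonical open sets): if `⟨𝒰⟩` is a nonempty canonical open set of `S_c(X)`,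
then `⋃⟨𝒰⟩ = ⋃𝒰`; moreover the union of any nonempty open subset of `S_c(X)` is open
in `X`. -/
theorem stmt_0 {X : Type*} [TopologicalSpace X] [T1Space X] [Infinite X]
    [FrechetUrysohnSpace X] (hnd : ¬ DiscreteTopology X)
    (𝒰 : Finset (Set X)) (h𝒰ne : 𝒰.Nonempty)
    (h𝒰open : ∀ U ∈ 𝒰, IsOpen U) (h𝒰nonempty : ∀ U ∈ 𝒰, U.Nonempty)
    (h𝒰disj : (↑𝒰 : Set (Set X)).Pairwise Disjoint)
    (hne : {S : Sc X | S.1 ⊆ ⋃₀ ↑𝒰 ∧ ∀ U ∈ 𝒰, (S.1 ∩ U).Nonempty}.Nonempty) :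
    (⋃ S ∈ {S : Sc X | S.1 ⊆ ⋃₀ ↑𝒰 ∧ ∀ U ∈ 𝒰, (S.1 ∩ U).Nonempty}, S.1) = ⋃₀ ↑𝒰 ∧
    ∀ O : Set (Sc X), IsOpen O → O.Nonempty → IsOpen (⋃ S ∈ O, S.1) := by
  constructor
  · apply Set.Subset.antisymm
    · exact Set.iUnion₂_subset fun S hS => hS.1
    · intro p hp
      obtain ⟨⟨S, x, hx⟩, hS1, hS2⟩ := hne
      refine Set.mem_iUnion₂.2 ⟨⟨insert p S, x, hx.insert_pt p⟩, ⟨?_, ?_⟩, Set.mem_insert _ _⟩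
      · exact Set.insert_subset hp hS1
      · exact fun U hU => (hS2 U hU).mono
          (Set.inter_subset_inter_left _ (Set.subset_insert _ _))
  · rintro O ⟨A, hA, rfl⟩ -
    rw [isOpen_iff_forall_mem_open]
    intro p hp
    obtain ⟨⟨S, x, hx⟩, hS, hpS⟩ := Set.mem_iUnion₂.1 hp
    obtain ⟨W, hW, hSW, h⟩ := vietoris_insert hA S hS
    exact ⟨W, fun q hq => Set.mem_iUnion₂.2
      ⟨⟨insert q S, x, hx.insert_pt q⟩, h q hq, Set.mem_insert _ _⟩, hW, hSW hpS⟩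
end

section
/- Suppose X is connected. Then for every S ∈ S_c(X), the set G(S) = {S ∪ F : F is a nonempty finite subset of X}, regarded as a subspace of S_c(X), is connected. -/
open Set Topology

def ScInsert {X : Type*} [TopologicalSpace X] [T1Space X] (T : Sc X) (p : X) : Sc X :=
  ⟨insert p T.1, T.2.imp fun _ h => h.insert_pt p⟩

theorem continuous_ScInsert {X : Type*} [TopologicalSpace X] [T1Space X] (T : Sc X) :
    Continuous (ScInsert T) := by
  refine continuous_induced_rng.2 ?_
  refine continuous_generateFrom_iff.2 ?_
  rintro A (⟨U, hU, rfl⟩ | ⟨U, hU, rfl⟩)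
  · by_cases hT : T.1 ⊆ U
    · convert hU using 1
      ext p
      simp [ScInsert, insert_subset_iff, hT]
    · convert isOpen_empty using 1
      ext p
      simp [ScInsert, insert_subset_iff, hT]
  · by_cases hT : (T.1 ∩ U).Nonempty
    · convert isOpen_univ using 1
      ext p
      simp only [ScInsert, mem_preimage, Function.comp, mem_setOf_eq, mem_univ, iff_true]
      exact hT.mono (inter_subset_inter_left _ (subset_insert _ _))
    · convert hU using 1
      ext p
      simp only [ScInsert, mem_preimage, Function.comp, mem_setOf_eq]
      constructor
      · rintro ⟨z, rfl | hz, hzU⟩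
        · exact hzU
        · exact absurd ⟨z, hz, hzU⟩ hT
      · intro h
        exact ⟨p, mem_insert _ _, h⟩

/-- If `X` is connected then, for every `S ∈ S_c(X)`, the set
`G(S) = {S ∪ F : F a nonempty finite subset of X}` is a connected subspace of `S_c(X)`. -/
theorem stmt_1 {X : Type*} [TopologicalSpace X] [T1Space X] [Infinite X]
    [FrechetUrysohnSpace X] (hnd : ¬ DiscreteTopology X)
    (hX : ConnectedSpace X) (S : Sc X) :
    IsConnected {T : Sc X | ∃ F : Set X, F.Finite ∧ F.Nonempty ∧ T.1 = S.1 ∪ F} := by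
  obtain ⟨x, hx⟩ := S.2
  have hxS : x ∈ S.1 := hx.2.2.2.1
  have hS : S.1 = S.1 ∪ {x} := by
    rw [union_eq_self_of_subset_right (singleton_subset_iff.2 hxS)]
  refine ⟨⟨S, {x}, finite_singleton x, singleton_nonempty x, hS⟩, ?_⟩
  have key : ∀ F : Set X, F.Finite → ∀ T : Sc X, T.1 = S.1 ∪ F →
      ∃ t ⊆ {T : Sc X | ∃ F : Set X, F.Finite ∧ F.Nonempty ∧ T.1 = S.1 ∪ F},
        S ∈ t ∧ T ∈ t ∧ IsPreconnected t := by
    intro F hF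
    induction F, hF using Set.Finite.induction_on with
    | empty =>
      intro T hT
      have : T = S := Subtype.ext (by simpa using hT)
      subst this
      exact ⟨{T}, by
        rintro _ rfl
        exact ⟨{x}, finite_singleton x, singleton_nonempty x, hS⟩, rfl, rfl,
        isPreconnected_singleton⟩
    | @insert a F ha hF ih =>
      intro T hT
      have hR : ∃ R : Sc X, R.1 = S.1 ∪ F := by
        clear ih hT ha
        induction F, hF using Set.Finite.induction_on with
        | empty => exact ⟨S, by simp⟩
        | @insert b F hb hF ih =>
          obtain ⟨R, hR⟩ := ih
          exact ⟨ScInsert R b, by simp [ScInsert, hR]⟩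
      obtain ⟨R, hR⟩ := hR
      obtain ⟨t, htG, hSt, hRt, ht⟩ := ih R hR
      refine ⟨t ∪ range (ScInsert R), ?_, Or.inl hSt, Or.inr ⟨a, ?_⟩, ?_⟩
      · refine union_subset htG ?_
        rintro _ ⟨b, rfl⟩
        exact ⟨insert b F, hF.insert b, insert_nonempty _ _, by simp [ScInsert, hR]⟩
      · exact Subtype.ext (by simp [ScInsert, hR, hT])
      · refine IsPreconnected.union R hRt ⟨x, ?_⟩ ht
          (isPreconnected_range (continuous_ScInsert R))
        have : x ∈ R.1 := by rw [hR]; exact Or.inl hxS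
        exact Subtype.ext (insert_eq_of_mem this)
  refine isPreconnected_of_forall S ?_
  rintro T ⟨F, hF, -, hT⟩
  exact key F hF T hT
end

section
/- Suppose X is connected. Then for every S ∈ S_c(X), the set H(S) = {T ∈ S_c(X) : S ⊆ T}, regarded as a subspace of S_c(X), is connected. -/
open Set Topology

theorem isNCS_union {X : Type*} [TopologicalSpace X] [T1Space X] {S : Set X} {x : X}
    (h : IsNCS S x) {F : Set X} (hF : F.Finite) : IsNCS (S ∪ F) x := by
  obtain ⟨h1, h2, h3, h4, h5, h6, h7⟩ := h
  refine ⟨h1.mono subset_union_left, h2.union hF.countable, h3.union hF.isClosed, Or.inl h4,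
    ?_, ?_, ?_⟩
  · rintro ⟨U, hU, hUS⟩
    refine h5 ⟨U, hU, Subset.antisymm ?_ ?_⟩
    · rw [← hUS]
      exact inter_subset_inter_right _ subset_union_left
    · rintro y rfl
      have : y ∈ U ∩ (S ∪ F) := by rw [hUS]; rfl
      exact ⟨this.1, h4⟩
  · intro y hy hyx
    have key : ∃ V : Set X, IsOpen V ∧ y ∈ V ∧ V ∩ S ⊆ {y} := by
      by_cases hyS : y ∈ S
      · obtain ⟨U, hU, hUS⟩ := h6 y hyS hyx
        have : y ∈ U ∩ S := by rw [hUS]; rfl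
        exact ⟨U, hU, this.1, hUS.subset⟩
      · exact ⟨Sᶜ, h3.isOpen_compl, hyS, fun z hz => absurd hz.2 hz.1⟩
    obtain ⟨V, hV, hyV, hVS⟩ := key
    refine ⟨V ∩ (F \ {y})ᶜ, hV.inter (hF.subset sdiff_subset).isClosed.isOpen_compl, ?_⟩
    apply Subset.antisymm
    · rintro z ⟨⟨hz1, hz2⟩, hz3 | hz3⟩
      · exact hVS ⟨hz1, hz3⟩
      · by_contra hne
        exact hz2 ⟨hz3, hne⟩
    · rintro z rfl
      exact ⟨⟨hyV, fun hh => hh.2 rfl⟩, hy⟩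
  · intro U hU hxU
    rw [union_sdiff_distrib]
    exact (h7 U hU hxU).union (hF.subset sdiff_subset)

def addF {X : Type*} [TopologicalSpace X] [T1Space X] (S : Sc X) (F : Set X)
    (hF : F.Finite) : Sc X :=
  ⟨S.1 ∪ F, S.2.imp fun _ h => isNCS_union h hF⟩

theorem Sc_tendsto {X ι : Type*} [TopologicalSpace X] {l : Filter ι} {f : ι → Sc X} {T : Sc X}
    (h1 : ∀ U, IsOpen U → T.1 ⊆ U → ∀ᶠ i in l, (f i).1 ⊆ U)
    (h2 : ∀ U, IsOpen U → (T.1 ∩ U).Nonempty → ∀ᶠ i in l, ((f i).1 ∩ U).Nonempty) :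
    Filter.Tendsto f l (𝓝 T) := by
  letI := vietorisTopology X
  have hn : 𝓝 T = Filter.comap (fun S : Sc X => S.1) (𝓝 T.1) := nhds_induced _ _
  rw [hn, Filter.tendsto_comap_iff]
  refine TopologicalSpace.tendsto_nhds_generateFrom_iff.2 ?_
  rintro A (⟨U, hU, rfl⟩ | ⟨U, hU, rfl⟩) hT
  · exact h1 U hU hT
  · exact h2 U hU hT

theorem continuous_addF {X : Type*} [TopologicalSpace X] [T1Space X] (S : Sc X) (F : Set X)
    (hF : F.Finite) : Continuous (fun a => addF S (insert a F) (hF.insert a)) := by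
  rw [continuous_iff_continuousAt]
  intro a
  refine Sc_tendsto ?_ ?_
  · intro U hU hT
    have ha : a ∈ U := hT (Or.inr (Or.inl rfl))
    filter_upwards [hU.mem_nhds ha] with b hb
    rintro z (hz | rfl | hz)
    · exact hT (Or.inl hz)
    · exact hb
    · exact hT (Or.inr (Or.inr hz))
  · rintro U hU ⟨z, hz | rfl | hz, hzU⟩
    · exact Filter.Eventually.of_forall fun b => ⟨z, Or.inl hz, hzU⟩
    · filter_upwards [hU.mem_nhds hzU] with b hb
      exact ⟨b, Or.inr (Or.inl rfl), hb⟩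
    · exact Filter.Eventually.of_forall fun b => ⟨z, Or.inr (Or.inr hz), hzU⟩

theorem exists_preconn {X : Type*} [TopologicalSpace X] [T1Space X] [ConnectedSpace X]
    (S : Sc X) (F : Set X) (hF : F.Finite) :
    ∃ s : Set (Sc X), s ⊆ {T | S.1 ⊆ T.1 ∧ ∃ G hG, T = addF S G hG} ∧
      addF S ∅ finite_empty ∈ s ∧ addF S F hF ∈ s ∧ IsPreconnected s := by
  induction F, hF using Set.Finite.induction_on with
  | empty =>
    exact ⟨{addF S ∅ finite_empty},
      by rintro _ rfl; exact ⟨subset_union_left, _, _, rfl⟩, rfl, rfl, isPreconnected_singleton⟩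
  | @insert a F ha hF ih =>
    obtain ⟨s, hs, h0, h1, hc⟩ := ih
    refine ⟨s ∪ range (fun a => addF S (insert a F) (hF.insert a)), ?_, Or.inl h0,
      Or.inr ⟨a, rfl⟩, ?_⟩
    · refine union_subset hs ?_
      rintro _ ⟨b, rfl⟩
      exact ⟨subset_union_left, _, _, rfl⟩
    · obtain ⟨x, hx⟩ := S.2
      refine IsPreconnected.union (addF S F hF) h1 ⟨x, ?_⟩ hc
        (isPreconnected_range (continuous_addF S F hF))
      apply Subtype.ext
      change S.1 ∪ insert x F = S.1 ∪ F
      exact union_insert.trans (insert_eq_of_mem (show x ∈ S.1 ∪ F from Or.inl hx.2.2.2.1))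

/-- If `X` is connected then, for every `S ∈ S_c(X)`, the set
`H(S) = {T ∈ S_c(X) : S ⊆ T}` is a connected subspace of `S_c(X)`. -/
theorem stmt_2 {X : Type*} [TopologicalSpace X] [T1Space X] [Infinite X]
    [FrechetUrysohnSpace X] (hnd : ¬ DiscreteTopology X)
    (hX : ConnectedSpace X) (S : Sc X) :
    IsConnected {T : Sc X | S.1 ⊆ T.1} := by
  refine ⟨⟨S, Subset.rfl⟩, ?_⟩
  have hC : IsPreconnected {T : Sc X | S.1 ⊆ T.1 ∧ ∃ G hG, T = addF S G hG} := by
    refine isPreconnected_of_forall (addF S ∅ finite_empty) ?_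
    rintro T ⟨_, G, hG, rfl⟩
    exact exists_preconn S G hG
  refine hC.subset_closure (fun T hT => hT.1) ?_
  intro T hT
  have ht : Filter.Tendsto
      (fun F : Finset T.1 => addF S (Subtype.val '' (F : Set T.1)) (F.finite_toSet.image _))
      Filter.atTop (𝓝 T) := by
    refine Sc_tendsto ?_ ?_
    · intro U hU hTU
      refine Filter.Eventually.of_forall fun F => ?_
      rintro z (hz | ⟨w, _, rfl⟩)
      · exact hTU (hT hz)
      · exact hTU w.2
    · rintro U hU ⟨z, hz, hzU⟩
      filter_upwards [Filter.eventually_ge_atTop ({⟨z, hz⟩} : Finset T.1)] with F hF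
      exact ⟨z, Or.inr ⟨⟨z, hz⟩, hF (Finset.mem_singleton_self _), rfl⟩, hzU⟩
  exact mem_closure_of_tendsto ht
    (Filter.Eventually.of_forall fun F => ⟨subset_union_left, _, _, rfl⟩)
end

section
/- Suppose X is connected. Then for every S ∈ S_c(X), the set M(S) = {T ∈ S_c(X) : x_T = x_S} of all nontrivial convergent sequences with the same limit point as S, regarded as a subspace of S_c(X), is connected. -/
open Set Topology

lemma ncs_union {X : Type*} [TopologicalSpace X] {T T' : Set X} {x : X}
    (h : IsNCS T x) (h' : IsNCS T' x) : IsNCS (T ∪ T') x := by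
  obtain ⟨a1, a2, a3, a4, a5, a6, a7⟩ := h
  obtain ⟨b1, b2, b3, b4, b5, b6, b7⟩ := h'
  refine ⟨a1.mono subset_union_left, a2.union b2, a3.union b3, Or.inl a4, ?_, ?_, ?_⟩
  · rintro ⟨U, hU, hUx⟩
    refine a5 ⟨U, hU, ?_⟩
    ext z
    have := Set.ext_iff.1 hUx z
    simp only [mem_inter_iff, mem_union, mem_singleton_iff] at this ⊢
    constructor
    · rintro ⟨h1, h2⟩; exact this.1 ⟨h1, Or.inl h2⟩
    · rintro rfl; exact ⟨(this.2 rfl).1, a4⟩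
  · intro y hy hyx
    have key : ∀ A : Set X, IsClosed A →
        (∀ y ∈ A, y ≠ x → ∃ U : Set X, IsOpen U ∧ U ∩ A = {y}) →
        ∃ U : Set X, IsOpen U ∧ y ∈ U ∧ ∀ z ∈ U, z ∈ A → z = y := by
      intro A hA hA6
      by_cases hyA : y ∈ A
      · obtain ⟨U, hU, hUy⟩ := hA6 y hyA hyx
        have hy' : y ∈ U ∩ A := by rw [hUy]; rfl
        refine ⟨U, hU, hy'.1, fun z hz hzA => ?_⟩
        have : z ∈ U ∩ A := ⟨hz, hzA⟩
        rw [hUy] at this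
        exact this
      · exact ⟨Aᶜ, hA.isOpen_compl, hyA, fun z hz hzA => absurd hzA hz⟩
    obtain ⟨U, hU, hyU, h1⟩ := key T a3 a6
    obtain ⟨V, hV, hyV, h2⟩ := key T' b3 b6
    refine ⟨U ∩ V, hU.inter hV, ?_⟩
    ext z
    constructor
    · rintro ⟨⟨hzU, hzV⟩, hz | hz⟩
      · exact h1 z hzU hz
      · exact h2 z hzV hz
    · rintro rfl
      exact ⟨⟨hyU, hyV⟩, hy⟩
  · intro U hU hxU
    rw [union_diff_distrib]
    exact (a7 U hU hxU).union (b7 U hU hxU)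

lemma ncs_insert {X : Type*} [TopologicalSpace X] [T1Space X] {T : Set X} {x : X}
    (h : IsNCS T x) (p : X) : IsNCS (insert p T) x := by
  by_cases hp : p ∈ T
  · rwa [insert_eq_of_mem hp]
  obtain ⟨a1, a2, a3, a4, a5, a6, a7⟩ := h
  refine ⟨a1.mono (subset_insert _ _), a2.insert p, ?_, Or.inr a4, ?_, ?_, ?_⟩
  · rw [insert_eq]; exact isClosed_singleton.union a3
  · rintro ⟨U, hU, hUx⟩
    refine a5 ⟨U, hU, ?_⟩
    ext z
    have := Set.ext_iff.1 hUx z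
    simp only [mem_inter_iff, mem_insert_iff, mem_singleton_iff] at this ⊢
    constructor
    · rintro ⟨h1, h2⟩; exact this.1 ⟨h1, Or.inr h2⟩
    · rintro rfl; exact ⟨(this.2 rfl).1, a4⟩
  · rintro y (rfl | hy) hyx
    · refine ⟨Tᶜ, a3.isOpen_compl, ?_⟩
      ext z
      simp only [mem_inter_iff, mem_insert_iff, mem_singleton_iff, mem_compl_iff]
      constructor
      · rintro ⟨h1, h2 | h2⟩
        · exact h2
        · exact absurd h2 h1
      · rintro rfl; exact ⟨hp, Or.inl rfl⟩
    · obtain ⟨U, hU, hUy⟩ := a6 y hy hyx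
      refine ⟨U ∩ {p}ᶜ, hU.inter isOpen_compl_singleton, ?_⟩
      ext z
      have := Set.ext_iff.1 hUy z
      simp only [mem_inter_iff, mem_insert_iff, mem_singleton_iff, mem_compl_iff] at this ⊢
      constructor
      · rintro ⟨⟨h1, h2⟩, h3 | h3⟩
        · exact absurd h3 h2
        · exact this.1 ⟨h1, h3⟩
      · rintro rfl
        exact ⟨⟨(this.2 rfl).1, fun h => hp (h ▸ hy)⟩, Or.inr hy⟩
  · intro U hU hxU
    refine ((a7 U hU hxU).insert p).subset ?_
    rintro z ⟨rfl | hz, hzU⟩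
    · exact Or.inl rfl
    · exact Or.inr ⟨hz, hzU⟩

lemma ncs_union_finset {X : Type*} [TopologicalSpace X] [T1Space X] {T : Set X} {x : X}
    (h : IsNCS T x) {F : Set X} (hF : F.Finite) : IsNCS (F ∪ T) x := by
  induction F, hF using Set.Finite.induction_on with
  | empty => simpa using h
  | insert _ _ ih => rw [insert_union]; exact ncs_insert ih _

lemma sc_preconn_fin {X : Type*} [TopologicalSpace X] [T1Space X]
    (hX : ConnectedSpace X) (x : X) (T : Sc X) (hT : IsNCS T.1 x) :
    IsPreconnected {V : Sc X | ∃ F : Set X, F.Finite ∧ V.1 = F ∪ T.1} := by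
  refine isPreconnected_of_forall T ?_
  rintro V ⟨F, hF, hV⟩
  induction F, hF using Set.Finite.induction_on generalizing V with
  | empty =>
    have : V = T := Subtype.ext (by simpa using hV)
    subst this
    refine ⟨{V}, ?_, rfl, rfl, isPreconnected_singleton⟩
    rintro _ rfl
    exact ⟨∅, finite_empty, by simp⟩
  | @insert p F hp hF ih =>
    have hW := ncs_union_finset hT hF
    let W : Sc X := ⟨F ∪ T.1, x, hW⟩
    obtain ⟨s, hs, hTs, hWs, hc⟩ := ih W rfl
    let f : X → Sc X := fun q => ⟨insert q (F ∪ T.1), x, ncs_insert hW q⟩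
    have hf : Continuous f := by
      letI := vietorisTopology X
      refine continuous_induced_rng.2 (continuous_generateFrom_iff.2 ?_)
      rintro _ (⟨U, hU, rfl⟩ | ⟨U, hU, rfl⟩)
      · by_cases h : F ∪ T.1 ⊆ U
        · convert hU using 1
          ext q
          simp only [mem_preimage, Function.comp, mem_setOf_eq, f, insert_subset_iff, h, and_true]
        · convert isOpen_empty using 1
          ext q
          simp only [mem_preimage, Function.comp, mem_setOf_eq, f, insert_subset_iff, h, and_false,
            mem_empty_iff_false]
      · by_cases h : ((F ∪ T.1) ∩ U).Nonempty
        · convert isOpen_univ using 1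
          ext q
          simp only [mem_preimage, Function.comp, mem_setOf_eq, f, mem_univ, iff_true]
          exact h.mono (inter_subset_inter_left _ (subset_insert _ _))
        · convert hU using 1
          ext q
          simp only [mem_preimage, Function.comp, mem_setOf_eq, f]
          constructor
          · rintro ⟨z, rfl | hz, hzU⟩
            · exact hzU
            · exact absurd ⟨z, hz, hzU⟩ h
          · intro hq; exact ⟨q, Or.inl rfl, hq⟩
    have hxW : f x = W := Subtype.ext (insert_eq_of_mem (Or.inr hT.2.2.2.1))
    have hpV : f p = V := Subtype.ext (by rw [hV, insert_union])
    refine ⟨s ∪ range f, ?_, Or.inl hTs, Or.inr ⟨p, hpV⟩,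
      hc.union W hWs ⟨x, hxW⟩ (isPreconnected_range hf)⟩
    rintro A (hA | ⟨q, rfl⟩)
    · exact hs hA
    · exact ⟨insert q F, hF.insert q, (insert_union).symm⟩

lemma sc_preconn {X : Type*} [TopologicalSpace X] [T1Space X]
    (hX : ConnectedSpace X) (x : X) (T : Sc X) (hT : IsNCS T.1 x) :
    IsPreconnected {V : Sc X | IsNCS V.1 x ∧ T.1 ⊆ V.1} := by
  refine (sc_preconn_fin hX x T hT).subset_closure ?_ ?_
  · rintro V ⟨F, hF, hV⟩
    refine ⟨?_, ?_⟩
    · rw [hV]; exact ncs_union_finset hT hF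
    · rw [hV]; exact subset_union_right
  · rintro V ⟨hV, hTV⟩
    let f : Finset X → Sc X := fun F =>
      ⟨(↑F ∩ V.1) ∪ T.1, x, ncs_union_finset hT (F.finite_toSet.inter_of_left _)⟩
    have hf : Filter.Tendsto f Filter.atTop (𝓝 V) := by
      letI := vietorisTopology X
      have hi : IsInducing (fun S : Sc X => S.1) := ⟨rfl⟩
      rw [hi.tendsto_nhds_iff]
      refine TopologicalSpace.tendsto_nhds_generateFrom_iff.2 ?_
      rintro _ (⟨U, hU, rfl⟩ | ⟨U, hU, rfl⟩) hVU
      · refine Filter.Eventually.of_forall fun F => ?_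
        exact (union_subset inter_subset_right hTV).trans hVU
      · obtain ⟨z, hz, hzU⟩ := hVU
        filter_upwards [Filter.eventually_ge_atTop {z}] with F hF
        exact ⟨z, Or.inl ⟨hF (Finset.mem_singleton_self z), hz⟩, hzU⟩
    exact mem_closure_of_tendsto hf
      (Filter.Eventually.of_forall fun F => ⟨_, F.finite_toSet.inter_of_left _, rfl⟩)

/-- If `X` is connected then, for every `S ∈ S_c(X)` with limit point `x`, the set
`M(S) = {T ∈ S_c(X) : x_T = x_S}` is a connected subspace of `S_c(X)`. -/
theorem stmt_3 {X : Type*} [TopologicalSpace X] [T1Space X] [Infinite X]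
    [FrechetUrysohnSpace X] (hnd : ¬ DiscreteTopology X)
    (hX : ConnectedSpace X) (S : Sc X) (x : X) (hx : IsNCS S.1 x) :
    IsConnected {T : Sc X | IsNCS T.1 x} := by
  refine ⟨⟨S, hx⟩, isPreconnected_of_forall S ?_⟩
  intro T hT
  have hU := ncs_union hx hT
  let W : Sc X := ⟨S.1 ∪ T.1, x, hU⟩
  refine ⟨{V : Sc X | IsNCS V.1 x ∧ S.1 ⊆ V.1} ∪ {V : Sc X | IsNCS V.1 x ∧ T.1 ⊆ V.1},
    ?_, Or.inl ⟨hx, Subset.rfl⟩, Or.inr ⟨hT, Subset.rfl⟩,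
    (sc_preconn hX x S hx).union W ⟨hU, subset_union_left⟩
      ⟨hU, subset_union_right⟩ (sc_preconn hX x T hT)⟩
  rintro A (hA | hA)
  · exact hA.1
  · exact hA.1
end

section
/- For every S ∈ S_c(X), the set M(S) = {T ∈ S_c(X) : x_T = x_S} is a dense subset of N(x_S) = {T ∈ S_c(X) : x_S ∈ T} in the relative Vietoris topology. -/
open Set Topology

theorem ncs_aux {X : Type*} [TopologicalSpace X] [T1Space X] {S : Set X} {x : X}
    (h : IsNCS S x) {U F : Set X} (hU : IsOpen U) (hxU : x ∈ U) (hF : F.Finite) :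
    IsNCS (F ∪ (S ∩ U)) x := by
  obtain ⟨h1, h2, h3, h4, h5, h6, h7⟩ := h
  have hfin := h7 U hU hxU
  refine ⟨?_, ?_, ?_, Or.inr ⟨h4, hxU⟩, ?_, ?_, ?_⟩
  · intro hf
    apply h1
    refine ((hf.subset subset_union_right).union hfin).subset ?_
    intro y hy
    by_cases hyU : y ∈ U
    · exact Or.inl ⟨hy, hyU⟩
    · exact Or.inr ⟨hy, hyU⟩
  · exact hF.countable.union (h2.mono inter_subset_left)
  · refine hF.isClosed.union ?_
    have hV : ∀ y ∈ S \ U, ∃ V : Set X, IsOpen V ∧ V ∩ S = {y} := by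
      intro y hy
      refine h6 y hy.1 ?_
      rintro rfl
      exact hy.2 hxU
    choose! V hVo hVS using hV
    have : S ∩ U = S \ ⋃ y ∈ S \ U, V y := by
      ext z
      simp only [mem_inter_iff, mem_sdiff, mem_iUnion, not_exists]
      constructor
      · rintro ⟨hz, hzU⟩
        refine ⟨hz, ?_⟩
        intro y hy hzy
        have h8 : z ∈ V y ∩ S := ⟨hzy, hz⟩
        rw [hVS y hy] at h8
        have h9 : z = y := h8
        exact hy.2 (h9 ▸ hzU)
      · rintro ⟨hz, hn⟩
        refine ⟨hz, ?_⟩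
        by_contra hzU
        have h8 : z ∈ V z ∩ S := by
          rw [hVS z ⟨hz, hzU⟩]
          rfl
        exact hn z ⟨hz, hzU⟩ h8.1
    rw [this]
    exact h3.sdiff (isOpen_biUnion hVo)
  · rintro ⟨W, hW, hWx⟩
    apply h5
    refine ⟨W ∩ U, hW.inter hU, ?_⟩
    ext z
    constructor
    · rintro ⟨⟨a, b⟩, c⟩
      rw [← hWx]
      exact ⟨a, Or.inr ⟨c, b⟩⟩
    · intro hz
      have hz' : z = x := hz
      subst hz'
      have : z ∈ W ∩ (F ∪ S ∩ U) := by
        rw [hWx]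
        rfl
      exact ⟨⟨this.1, hxU⟩, h4⟩
  · intro y hy hyx
    have key : ∃ V : Set X, IsOpen V ∧ y ∈ V ∧ V ∩ S ⊆ {y} := by
      by_cases hyS : y ∈ S
      · obtain ⟨V, hV, hVy⟩ := h6 y hyS hyx
        have : y ∈ V ∩ S := by
          rw [hVy]
          rfl
        exact ⟨V, hV, this.1, hVy.subset⟩
      · exact ⟨Sᶜ, h3.isOpen_compl, hyS, fun z hz => absurd hz.2 hz.1⟩
    obtain ⟨V, hV, hyV, hVS⟩ := key
    refine ⟨V \ (F \ {y}), hV.sdiff (hF.subset sdiff_subset).isClosed, ?_⟩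
    ext z
    constructor
    · rintro ⟨⟨a, b⟩, c | c⟩
      · by_contra hz
        exact b ⟨c, hz⟩
      · exact hVS ⟨a, c.1⟩
    · intro hz
      have hz' : z = y := hz
      subst hz'
      exact ⟨⟨hyV, fun h => h.2 rfl⟩, hy⟩
  · intro W hW hxW
    refine (hF.union (h7 W hW hxW)).subset ?_
    rintro z ⟨a | a, b⟩
    · exact Or.inl a
    · exact Or.inr ⟨a.1, b⟩

theorem vietoris_aux {X : Type*} [TopologicalSpace X] {A : Set (Set X)}
    (hA : IsOpen[vietorisTopology X] A) (T : Set X) (hT : T ∈ A) :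
    ∃ F U : Set X, F.Finite ∧ IsOpen U ∧ F ⊆ T ∧ T ⊆ U ∧
      ∀ G : Set X, F ⊆ G → G ⊆ U → G ∈ A := by
  change TopologicalSpace.GenerateOpen _ A at hA
  induction hA with
  | basic A h =>
    rcases h with ⟨U, hU, rfl⟩ | ⟨U, hU, rfl⟩
    · exact ⟨∅, U, finite_empty, hU, empty_subset _, hT, fun G _ h => h⟩
    · obtain ⟨p, hp, hpU⟩ := hT
      exact ⟨{p}, univ, finite_singleton p, isOpen_univ, singleton_subset_iff.2 hp,
        subset_univ _, fun G h _ => ⟨p, h rfl, hpU⟩⟩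
  | univ =>
    exact ⟨∅, univ, finite_empty, isOpen_univ, empty_subset _, subset_univ _,
      fun G _ _ => trivial⟩
  | inter A B _ _ ihA ihB =>
    obtain ⟨F, U, a, b, c, d, e⟩ := ihA hT.1
    obtain ⟨F', U', a', b', c', d', e'⟩ := ihB hT.2
    exact ⟨F ∪ F', U ∩ U', a.union a', b.inter b', union_subset c c', subset_inter d d',
      fun G h h' => ⟨e G (subset_union_left.trans h) (h'.trans inter_subset_left),
        e' G (subset_union_right.trans h) (h'.trans inter_subset_right)⟩⟩
  | sUnion C _ ih =>
    obtain ⟨B, hB, hTB⟩ := hT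
    obtain ⟨F, U, a, b, c, d, e⟩ := ih B hB hTB
    exact ⟨F, U, a, b, c, d, fun G h h' => ⟨B, hB, e G h h'⟩⟩

/-- For every `S ∈ S_c(X)` with limit point `x = x_S`, the set
`M(S) = {T ∈ S_c(X) : x_T = x_S}` is a dense subset of `N(x_S) = {T ∈ S_c(X) : x_S ∈ T}`. -/
theorem stmt_5 {X : Type*} [TopologicalSpace X] [T1Space X] [Infinite X]
    [FrechetUrysohnSpace X] (hnd : ¬ DiscreteTopology X)
    (S : Sc X) (x : X) (hx : IsNCS S.1 x) :
    {T : Sc X | IsNCS T.1 x} ⊆ {T : Sc X | x ∈ T.1} ∧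
    {T : Sc X | x ∈ T.1} ⊆ closure {T : Sc X | IsNCS T.1 x} := by
  refine ⟨fun T hT => hT.2.2.2.1, ?_⟩
  intro T hT
  rw [mem_closure_iff]
  intro O hO hTO
  obtain ⟨A, hA, rfl⟩ := (@isOpen_induced_iff _ _ (vietorisTopology X) _ _).1 hO
  obtain ⟨F, U, a, b, c, d, e⟩ := vietoris_aux hA T.1 hTO
  have hN := ncs_aux hx b (d hT) a
  exact ⟨⟨F ∪ (S.1 ∩ U), x, hN⟩,
    e _ subset_union_left (union_subset (c.trans d) inter_subset_right), hN⟩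
end

section
/- The hyperspace S_c(X) of nontrivial convergent sequences of X is connected if and only if X is connected. -/
open Set Topology

theorem IsNCS.add {X : Type*} [TopologicalSpace X] [T1Space X] {S : Set X} {x : X}
    (h : IsNCS S x) (y : X) : IsNCS (insert y S) x := by
  by_cases hy : y ∈ S
  · rwa [insert_eq_of_mem hy]
  obtain ⟨h1, h2, h3, h4, h5, h6, h7⟩ := h
  refine ⟨h1.mono (subset_insert _ _), h2.insert y, ?_, mem_insert_of_mem _ h4, ?_, ?_, ?_⟩
  · rw [insert_eq]; exact isClosed_singleton.union h3
  · rintro ⟨U, hU, hUS⟩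
    refine h5 ⟨U, hU, ?_⟩
    ext z
    have hz := Set.ext_iff.1 hUS z
    have hx := Set.ext_iff.1 hUS x
    simp only [mem_inter_iff, mem_insert_iff, mem_singleton_iff] at hz hx ⊢
    constructor
    · intro h; exact hz.1 ⟨h.1, Or.inr h.2⟩
    · rintro rfl; exact ⟨(hz.2 rfl).1, h4⟩
  · intro z hz hzx
    by_cases hzy : z = y
    · subst hzy
      refine ⟨Sᶜ, h3.isOpen_compl, ?_⟩
      ext w
      simp only [mem_inter_iff, mem_insert_iff, mem_singleton_iff, mem_compl_iff]
      constructor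
      · tauto
      · rintro rfl; exact ⟨hy, Or.inl rfl⟩
    · have hzS : z ∈ S := (mem_insert_iff.1 hz).resolve_left hzy
      obtain ⟨U, hU, hUS⟩ := h6 z hzS hzx
      refine ⟨U ∩ {y}ᶜ, hU.inter isClosed_singleton.isOpen_compl, ?_⟩
      ext w
      have hw := Set.ext_iff.1 hUS w
      simp only [mem_inter_iff, mem_insert_iff, mem_singleton_iff, mem_compl_iff] at hw ⊢
      constructor
      · tauto
      · rintro rfl
        exact ⟨⟨(hw.2 rfl).1, hzy⟩, Or.inr hzS⟩
  · intro U hU hxU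
    refine ((h7 U hU hxU).insert y).subset ?_
    rintro w ⟨rfl | hw, hwU⟩
    · exact mem_insert _ _
    · exact mem_insert_of_mem _ ⟨hw, hwU⟩

theorem IsNCS.restrict {X : Type*} [TopologicalSpace X] {S : Set X} {x : X}
    (h : IsNCS S x) {U : Set X} (hU : IsOpen U) (hx : x ∈ U) : IsNCS (S ∩ U) x := by
  obtain ⟨h1, h2, h3, h4, h5, h6, h7⟩ := h
  refine ⟨?_, h2.mono inter_subset_left, ?_, ⟨h4, hx⟩, ?_, ?_, ?_⟩
  · intro hf
    apply h1
    rw [← inter_union_diff S U]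
    exact hf.union (h7 U hU hx)
  · have : S ∩ U = S ∩ (⋃₀ {V | IsOpen V ∧ V ∩ S ⊆ Uᶜ})ᶜ := by
      ext z
      simp only [mem_inter_iff, mem_compl_iff, mem_sUnion, mem_setOf_eq, not_exists, not_and]
      constructor
      · rintro ⟨hz, hzU⟩
        exact ⟨hz, fun V hV hzV => hV.2 ⟨hzV, hz⟩ hzU⟩
      · rintro ⟨hz, H⟩
        refine ⟨hz, ?_⟩
        by_contra hzU
        obtain ⟨V, hV, hVS⟩ := h6 z hz (by rintro rfl; exact hzU hx)
        refine H V ⟨hV, ?_⟩ ?_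
        · rw [hVS]; simpa using hzU
        · have : z ∈ V ∩ S := by rw [hVS]; rfl
          exact this.1
    rw [this]
    exact h3.inter (isOpen_sUnion fun V hV => hV.1).isClosed_compl
  · rintro ⟨V, hV, hVS⟩
    refine h5 ⟨V ∩ U, hV.inter hU, ?_⟩
    rw [← hVS]; ext; simp only [mem_inter_iff]; tauto
  · rintro y ⟨hy, hyU⟩ hyx
    obtain ⟨V, hV, hVS⟩ := h6 y hy hyx
    refine ⟨V, hV, ?_⟩
    rw [← inter_assoc, hVS]
    simpa using hyU
  · intro V hV hxV
    exact (h7 V hV hxV).subset (fun z hz => ⟨hz.1.1, hz.2⟩)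

theorem vietoris_basic {X : Type*} [TopologicalSpace X] {O : Set (Set X)}
    (hO : IsOpen[vietorisTopology X] O) {G : Set X} (hG : G ∈ O) :
    ∃ U E : Set X, IsOpen U ∧ G ⊆ U ∧ E.Finite ∧ E ⊆ G ∧
      ∀ F : Set X, E ⊆ F → F ⊆ U → F ∈ O := by
  change TopologicalSpace.GenerateOpen _ O at hO
  induction hO with
  | basic s hs =>
    rcases hs with ⟨U, hU, rfl⟩ | ⟨U, hU, rfl⟩
    · exact ⟨U, ∅, hU, hG, finite_empty, empty_subset _, fun F _ h => h⟩
    · obtain ⟨z, hz, hzU⟩ := hG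
      exact ⟨univ, {z}, isOpen_univ, subset_univ _, finite_singleton _, by simpa using hz,
        fun F h _ => ⟨z, h rfl, hzU⟩⟩
  | univ => exact ⟨univ, ∅, isOpen_univ, subset_univ _, finite_empty, empty_subset _,
      fun _ _ _ => trivial⟩
  | inter s t _ _ ihs iht =>
    obtain ⟨U, E, a1, a2, a3, a4, a5⟩ := ihs hG.1
    obtain ⟨V, D, b1, b2, b3, b4, b5⟩ := iht hG.2
    exact ⟨U ∩ V, E ∪ D, a1.inter b1, subset_inter a2 b2, a3.union b3, union_subset a4 b4,
      fun F h h' => ⟨a5 F (subset_union_left.trans h) (h'.trans inter_subset_left),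
        b5 F (subset_union_right.trans h) (h'.trans inter_subset_right)⟩⟩
  | sUnion K _ ih =>
    obtain ⟨s, hs, hGs⟩ := hG
    obtain ⟨U, E, a1, a2, a3, a4, a5⟩ := ih s hs hGs
    exact ⟨U, E, a1, a2, a3, a4, fun F h h' => ⟨s, hs, a5 F h h'⟩⟩

theorem Sc.isOpen_sub {X : Type*} [TopologicalSpace X] {U : Set X} (hU : IsOpen U) :
    IsOpen {T : Sc X | T.1 ⊆ U} :=
  ⟨{F | F ⊆ U}, TopologicalSpace.GenerateOpen.basic _ (Or.inl ⟨U, hU, rfl⟩), rfl⟩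

theorem Sc.isOpen_meet {X : Type*} [TopologicalSpace X] {U : Set X} (hU : IsOpen U) :
    IsOpen {T : Sc X | (T.1 ∩ U).Nonempty} :=
  ⟨{F | (F ∩ U).Nonempty}, TopologicalSpace.GenerateOpen.basic _ (Or.inr ⟨U, hU, rfl⟩), rfl⟩

/-- Add a point to a convergent sequence. -/
def Sc.ins {X : Type*} [TopologicalSpace X] [T1Space X] (S : Sc X) (y : X) : Sc X :=
  ⟨insert y S.1, S.2.imp fun _ h => h.add y⟩

theorem Sc.continuous_ins {X : Type*} [TopologicalSpace X] [T1Space X] (S : Sc X) :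
    Continuous S.ins := by
  refine continuous_induced_rng.2 (continuous_generateFrom_iff.2 ?_)
  rintro A (⟨U, hU, rfl⟩ | ⟨U, hU, rfl⟩)
  · by_cases h : S.1 ⊆ U
    · convert hU using 1
      ext y; simp [Sc.ins, insert_subset_iff, h]
    · convert isOpen_empty using 1
      ext y; simp [Sc.ins, insert_subset_iff, h]
  · by_cases h : (S.1 ∩ U).Nonempty
    · convert isOpen_univ using 1
      ext y
      simp only [mem_preimage, mem_setOf_eq, mem_univ, iff_true, Function.comp]
      exact h.mono (inter_subset_inter_left _ (subset_insert _ _))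
    · convert hU using 1
      ext y
      simp only [mem_preimage, mem_setOf_eq, Function.comp, Sc.ins]
      constructor
      · rintro ⟨z, rfl | hz, hzU⟩
        · exact hzU
        · exact absurd ⟨z, hz, hzU⟩ h
      · intro hy; exact ⟨y, mem_insert _ _, hy⟩

theorem Sc.ins_mem_iff {X : Type*} [TopologicalSpace X] [T1Space X] [PreconnectedSpace X]
    {A : Set (Sc X)} (hA : IsClopen A) (S : Sc X) (y : X) : S.ins y ∈ A ↔ S ∈ A := by
  obtain ⟨x, hx⟩ := S.2
  have hxS : S.ins x = S := Subtype.ext (insert_eq_of_mem hx.2.2.2.1)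
  have hc : IsClopen (S.ins ⁻¹' A) := hA.preimage S.continuous_ins
  rcases isClopen_iff.1 hc with h | h
  · have h1 : y ∉ S.ins ⁻¹' A := by rw [h]; exact notMem_empty _
    have h2 : x ∉ S.ins ⁻¹' A := by rw [h]; exact notMem_empty _
    rw [mem_preimage] at h1 h2
    rw [hxS] at h2
    tauto
  · have h1 : y ∈ S.ins ⁻¹' A := by rw [h]; exact mem_univ _
    have h2 : x ∈ S.ins ⁻¹' A := by rw [h]; exact mem_univ _
    rw [mem_preimage] at h1 h2
    rw [hxS] at h2
    tauto

theorem Sc.union_mem_iff {X : Type*} [TopologicalSpace X] [T1Space X] [PreconnectedSpace X]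
    {A : Set (Sc X)} (hA : IsClopen A) (S : Sc X) {E : Set X} (hE : E.Finite) :
    ∃ T : Sc X, T.1 = E ∪ S.1 ∧ (T ∈ A ↔ S ∈ A) := by
  induction E, hE using Set.Finite.induction_on with
  | empty => exact ⟨S, by simp, Iff.rfl⟩
  | insert _ _ ih =>
    obtain ⟨T, hT, h⟩ := ih
    rename_i a s _ _
    exact ⟨T.ins a, by simp [Sc.ins, hT, insert_union], (Sc.ins_mem_iff hA T a).trans h⟩

theorem Sc.mem_of_mem {X : Type*} [TopologicalSpace X] [T1Space X] [PreconnectedSpace X]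
    {A : Set (Sc X)} (hA : IsClopen A) (S T : Sc X) (hT : T ∈ A) : S ∈ A := by
  obtain ⟨y, hy⟩ := T.2
  rw [← Sc.ins_mem_iff hA S y]
  by_contra hn
  obtain ⟨O, hO, hOA⟩ := hA.compl.isOpen
  have hG : (S.ins y).1 ∈ O := by
    have : S.ins y ∈ Aᶜ := hn
    rw [← hOA] at this
    exact this
  obtain ⟨U, E, hU, hGU, hE, hEG, hF⟩ := vietoris_basic hO hG
  have hyU : y ∈ U := hGU (mem_insert _ _)
  let R : Sc X := ⟨T.1 ∩ U, y, hy.restrict hU hyU⟩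
  have hR : R ∈ A := by
    obtain ⟨T', hT', h⟩ := Sc.union_mem_iff hA R (hy.2.2.2.2.2.2 U hU hyU)
    have : T' = T := Subtype.ext (hT'.trans (diff_union_inter _ _))
    rw [this] at h
    exact h.1 hT
  obtain ⟨Q, hQ, h⟩ := Sc.union_mem_iff hA R hE
  have hQO : Q.1 ∈ O := hF _ (by rw [hQ]; exact subset_union_left)
    (by rw [hQ]; exact union_subset (hEG.trans hGU) inter_subset_right)
  have : Q ∈ Aᶜ := by rw [← hOA]; exact hQO
  exact this (h.2 hR)

theorem Sc.clopen_univ {X : Type*} [TopologicalSpace X] [T1Space X] [PreconnectedSpace (Sc X)]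
    {S : Set X} {x : X} (hS : IsNCS S x) {U : Set X} (hU : IsClopen U) (hx : x ∈ U) :
    U = univ := by
  by_contra hne
  obtain ⟨v, hv⟩ := (ne_univ_iff_exists_notMem U).1 hne
  have hc : IsClopen {T : Sc X | T.1 ⊆ U} := by
    refine ⟨⟨?_⟩, Sc.isOpen_sub hU.isOpen⟩
    convert Sc.isOpen_meet hU.compl.isOpen using 1
    ext T
    simp only [mem_compl_iff, mem_setOf_eq, inter_compl_nonempty_iff]
  let R : Sc X := ⟨S ∩ U, x, hS.restrict hU.isOpen hx⟩
  rcases isClopen_iff.1 hc with h | h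
  · have : R ∈ {T : Sc X | T.1 ⊆ U} := inter_subset_right
    rw [h] at this
    exact this
  · have : R.ins v ∈ {T : Sc X | T.1 ⊆ U} := by rw [h]; exact mem_univ _
    exact hv (this (mem_insert _ _))

/-- `S_c(X)` is connected iff `X` is connected. -/
theorem stmt_8 {X : Type*} [TopologicalSpace X] [T1Space X] [Infinite X]
    [FrechetUrysohnSpace X] (hnd : ¬ DiscreteTopology X) (hSc : Nonempty (Sc X)) :
    ConnectedSpace (Sc X) ↔ ConnectedSpace X := by
  obtain ⟨S, x, hx⟩ := hSc
  constructor
  · intro hc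
    have : PreconnectedSpace X := by
      refine preconnectedSpace_iff_clopen.2 fun U hU => ?_
      by_cases h : x ∈ U
      · exact Or.inr (Sc.clopen_univ hx hU h)
      · exact Or.inl (compl_univ_iff.1 (Sc.clopen_univ hx hU.compl h))
    exact { toPreconnectedSpace := this, toNonempty := ⟨x⟩ }
  · intro hc
    have : PreconnectedSpace (Sc X) := by
      refine preconnectedSpace_iff_clopen.2 fun A hA => ?_
      rcases A.eq_empty_or_nonempty with h | ⟨T, hT⟩
      · exact Or.inl h
      · exact Or.inr (eq_univ_of_forall fun R => Sc.mem_of_mem hA R T hT)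
    exact { toPreconnectedSpace := this, toNonempty := ⟨⟨S, x, hx⟩⟩ }
end

section
/- Let X be a Hausdorff space, let I = [0,1], let α : I → S_c(X) be continuous, and let p ∈ α(0). Then there exists a continuous map f : I → X such that f(0) = p and f(t) ∈ α(t) for all t ∈ I. -/
open Set Topology

section Helpers

variable {X : Type*} [TopologicalSpace X]

lemma sc_usc (α : unitInterval → Sc X) (hα : Continuous α) (t : unitInterval) (U : Set X)
    (hU : IsOpen U) (h : (α t).1 ⊆ U) : ∀ᶠ s in 𝓝 t, (α s).1 ⊆ U := by
  have ho : IsOpen {S : Sc X | S.1 ⊆ U} := by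
    refine (@isOpen_induced_iff _ _ (vietorisTopology X) _ _).2 ⟨{F | F ⊆ U}, ?_, rfl⟩
    exact TopologicalSpace.isOpen_generateFrom_of_mem (Or.inl ⟨U, hU, rfl⟩)
  exact (ho.preimage hα).mem_nhds h

lemma sc_lsc (α : unitInterval → Sc X) (hα : Continuous α) (t : unitInterval) (U : Set X)
    (hU : IsOpen U) (h : ((α t).1 ∩ U).Nonempty) : ∀ᶠ s in 𝓝 t, ((α s).1 ∩ U).Nonempty := by
  have ho : IsOpen {S : Sc X | (S.1 ∩ U).Nonempty} := by
    refine (@isOpen_induced_iff _ _ (vietorisTopology X) _ _).2 ⟨{F | (F ∩ U).Nonempty}, ?_, rfl⟩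
    exact TopologicalSpace.isOpen_generateFrom_of_mem (Or.inr ⟨U, hU, rfl⟩)
  exact (ho.preimage hα).mem_nhds h

lemma ncs_compact {S : Set X} {x : X} (h : IsNCS S x) : IsCompact S := by
  obtain ⟨-, -, -, hx, -, -, hfin⟩ := h
  rw [isCompact_iff_finite_subcover]
  intro ι U hUo hSU
  obtain ⟨i, hi⟩ := mem_iUnion.1 (hSU hx)
  have hc : IsCompact (S \ U i) := (hfin _ (hUo i) hi).isCompact
  obtain ⟨T, hT⟩ := hc.elim_finite_subcover U hUo (sdiff_subset.trans hSU)
  classical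
  refine ⟨insert i T, fun y hy => ?_⟩
  by_cases hyi : y ∈ U i
  · exact mem_biUnion (Finset.mem_insert_self i T) hyi
  · obtain ⟨j, hj, hyj⟩ := mem_iUnion₂.1 (hT ⟨hy, hyi⟩)
    exact mem_biUnion (Finset.mem_insert_of_mem hj) hyj

lemma ncs_sep [T2Space X] {S : Set X} {x : X} (h : IsNCS S x) (F : Set X) (hF : F.Finite)
    (hFS : F ⊆ S) (hxF : x ∉ F) : SeparatedNhds F (S \ F) := by
  have hiso := h.2.2.2.2.2.1
  have : ∀ y : F, ∃ U : Set X, IsOpen U ∧ U ∩ S = {y.1} := fun y =>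
    hiso y (hFS y.2) (fun e => hxF (e ▸ y.2))
  choose O hO hOS using this
  have e : S \ F = S \ ⋃ y, O y := by
    ext z
    simp only [mem_sdiff, mem_iUnion, not_exists]
    refine and_congr_right fun hz => ⟨fun hzF y hy => ?_, fun hz2 hzF => ?_⟩
    · have : z ∈ ({y.1} : Set X) := hOS y ▸ ⟨hy, hz⟩
      exact hzF (this ▸ y.2)
    · refine hz2 ⟨z, hzF⟩ ?_
      have : z ∈ O ⟨z, hzF⟩ ∩ S := by rw [hOS]; rfl
      exact this.1
  refine SeparatedNhds.of_isCompact_isCompact hF.isCompact ?_ disjoint_sdiff_right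
  rw [e]
  exact (ncs_compact h).diff (isOpen_iUnion hO)

lemma ncs_split [T2Space X] {S : Set X} {x : X} (h : IsNCS S x) (y : X) (hy : y ∈ S)
    (W : Set X) (hW : IsOpen W) (hyW : y ∈ W) :
    ∃ U V : Set X, IsOpen U ∧ IsOpen V ∧ Disjoint U V ∧ S ⊆ U ∪ V ∧ y ∈ U ∧ U ⊆ W := by
  by_cases hyx : y = x
  · subst hyx
    obtain ⟨U, V, hU, hV, hFU, hSV, hd⟩ := ncs_sep h (S \ W) (h.2.2.2.2.2.2 W hW hyW)
      sdiff_subset (fun hh => hh.2 hyW)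
    refine ⟨V ∩ W, U, hV.inter hW, hU, (hd.symm).mono_left inter_subset_left, ?_, ⟨?_, hyW⟩,
      inter_subset_right⟩
    · intro z hz
      by_cases hzW : z ∈ W
      · exact Or.inl ⟨hSV ⟨hz, fun hh => hh.2 hzW⟩, hzW⟩
      · exact Or.inr (hFU ⟨hz, hzW⟩)
    · exact hSV ⟨hy, fun hh => hh.2 hyW⟩
  · obtain ⟨U, V, hU, hV, hFU, hSV, hd⟩ := ncs_sep h {y} (finite_singleton y)
      (singleton_subset_iff.2 hy) (fun hh => hyx hh.symm)
    have hyU : y ∈ U := hFU rfl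
    refine ⟨U ∩ W, V, hU.inter hW, hV, hd.mono_left inter_subset_left, ?_, ⟨hyU, hyW⟩,
      inter_subset_right⟩
    intro z hz
    by_cases hzy : z = y
    · subst hzy
      exact Or.inl ⟨hyU, hyW⟩
    · exact Or.inr (hSV ⟨hz, hzy⟩)

/-- A constraint: on the interval `J`, the values are split by `U`, `V`. -/
structure SelCon (α : unitInterval → Sc X) where
  J : Set unitInterval
  U : Set X
  V : Set X
  hJ : IsClosed J
  hJo : J.OrdConnected
  hU : IsOpen U
  hV : IsOpen V
  hd : Disjoint U V
  hc : ∀ s ∈ J, (α s).1 ⊆ U ∪ V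

/-- The points `x`, `y` are on the same side of the constraint. -/
def SelCon.Same {α : unitInterval → Sc X} (c : SelCon α) (x y : X) : Prop :=
  (x ∉ c.V ∧ y ∉ c.V) ∨ (x ∉ c.U ∧ y ∉ c.U)

lemma sel_local (α : unitInterval → Sc X) (hα : Continuous α) (u : Finset (SelCon α))
    (t : unitInterval) : ∀ᶠ N in (𝓝 t).smallSets, ∀ s ∈ N, ∀ x ∈ (α s).1,
      ∃ g : unitInterval → X, (∀ r, g r ∈ (α r).1) ∧ g s = x ∧
        ∀ c ∈ u, ∀ a ∈ c.J ∩ N, ∀ b ∈ c.J ∩ N, c.Same (g a) (g b) := by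
  classical
  let W : (u → Bool) → Set X := fun σ =>
    ⋂ k : u, if t ∈ k.1.J then (if σ k then k.1.U else k.1.V) else univ
  have hWo : ∀ σ, IsOpen (W σ) := by
    intro σ
    refine isOpen_iInter_of_finite fun k => ?_
    split_ifs
    exacts [k.1.hU, k.1.hV, isOpen_univ]
  have E1 : ∀ᶠ s in 𝓝 t, ∀ σ, ((α t).1 ∩ W σ).Nonempty → ((α s).1 ∩ W σ).Nonempty := by
    rw [Filter.eventually_all]
    intro σ
    by_cases h : ((α t).1 ∩ W σ).Nonempty
    · filter_upwards [sc_lsc α hα t _ (hWo σ) h] with s hs _ using hs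
    · exact Filter.Eventually.of_forall fun s hs => absurd hs h
  have E2 : ∀ᶠ s in 𝓝 t, (α s).1 ⊆ ⋃ σ, ⋃ _ : ((α t).1 ∩ W σ).Nonempty, W σ := by
    refine sc_usc α hα t _ (isOpen_iUnion fun σ => isOpen_iUnion fun _ => hWo σ) ?_
    intro x hx
    have hxW : x ∈ W (fun k => decide (x ∈ k.1.U)) := by
      refine mem_iInter.2 fun k => ?_
      by_cases htk : t ∈ k.1.J
      · have := k.1.hc t htk hx
        by_cases hxU : x ∈ k.1.U
        · simp [htk, hxU]
        · simpa [htk, hxU] using this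
      · simp [htk]
    exact mem_iUnion₂.2 ⟨_, ⟨x, hx, hxW⟩, hxW⟩
  have E3 : ∀ᶠ s in 𝓝 t, ∀ k : u, s ∈ k.1.J → t ∈ k.1.J := by
    rw [Filter.eventually_all]
    intro k
    by_cases h : t ∈ k.1.J
    · exact Filter.Eventually.of_forall fun s _ => h
    · filter_upwards [k.1.hJ.isOpen_compl.mem_nhds h] with s hs hs2 using absurd hs2 hs
  have E := (E1.and (E2.and E3))
  refine Filter.Eventually.mono E.smallSets ?_
  intro N hN s hs x hx
  obtain ⟨σ, hσ, hxσ⟩ := mem_iUnion₂.1 ((hN s hs).2.1 hx)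
  have hne : ∀ r, ∃ y ∈ (α r).1, (r ∈ N → y ∈ W σ) ∧ (r = s → y = x) := by
    intro r
    by_cases hrs : r = s
    · subst hrs
      exact ⟨x, hx, fun _ => hxσ, fun _ => rfl⟩
    · by_cases hr : r ∈ N
      · obtain ⟨y, hy, hyW⟩ := (hN r hr).1 σ hσ
        exact ⟨y, hy, fun _ => hyW, fun h => absurd h hrs⟩
      · obtain ⟨z, hz⟩ := (α r).2
        exact ⟨z, hz.2.2.2.1, fun h => absurd h hr, fun h => absurd h hrs⟩
  choose g hg1 hg2 hg3 using hne
  refine ⟨g, hg1, hg3 s rfl, ?_⟩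
  rintro c hc a ⟨haJ, haN⟩ b ⟨hbJ, hbN⟩
  have ht : t ∈ c.J := (hN a haN).2.2 ⟨c, hc⟩ haJ
  have ha := mem_iInter.1 (hg2 a haN) ⟨c, hc⟩
  have hb := mem_iInter.1 (hg2 b hbN) ⟨c, hc⟩
  simp only [ht, if_true] at ha hb
  by_cases h : σ ⟨c, hc⟩ = true
  · simp only [h, if_true] at ha hb
    exact Or.inl ⟨disjoint_left.1 c.hd ha, disjoint_left.1 c.hd hb⟩
  · simp only [h] at ha hb
    exact Or.inr ⟨disjoint_right.1 c.hd ha, disjoint_right.1 c.hd hb⟩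

lemma sel_finite (α : unitInterval → Sc X) (hα : Continuous α) (u : Finset (SelCon α))
    (p : X) (hp : p ∈ (α 0).1) :
    ∃ f : unitInterval → X, (∀ r, f r ∈ (α r).1) ∧ f 0 = p ∧
        ∀ c ∈ u, ∀ a ∈ c.J, ∀ b ∈ c.J, c.Same (f a) (f b) := by
  classical
  let P : Set unitInterval := {t | ∃ f : unitInterval → X, (∀ r, f r ∈ (α r).1) ∧ f 0 = p ∧
        ∀ c ∈ u, ∀ a ∈ c.J ∩ Iic t, ∀ b ∈ c.J ∩ Iic t, c.Same (f a) (f b)}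
  have key : ∀ t, ∃ N ∈ 𝓝 t, ∀ s ∈ N, ∀ s' ∈ N, s ∈ P → s' ∈ P := by
    intro t
    obtain ⟨N₀, hN₀, hN⟩ := Filter.eventually_smallSets.1 (sel_local α hα u t)
    obtain ⟨b, c, -, hbc, hsub⟩ := exists_Icc_mem_subset_of_mem_nhds hN₀
    refine ⟨Icc b c, hbc, ?_⟩
    rintro s hs s' hs' ⟨f, hf, hf0, hfc⟩
    rcases le_or_gt s' s with hle | hlt
    · refine ⟨f, hf, hf0, fun c hc a ha b hb => hfc c hc a ⟨ha.1, ha.2.trans hle⟩ b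
        ⟨hb.1, hb.2.trans hle⟩⟩
    · obtain ⟨g, hg, hgs, hgc⟩ := hN _ hsub s hs (f s) (hf s)
      have hNr : ∀ r, s < r → r ≤ s' → r ∈ Icc b c := fun r h1 h2 =>
        ⟨hs.1.trans h1.le, h2.trans hs'.2⟩
      have mixed : ∀ k ∈ u, ∀ a ∈ k.J, ∀ r ∈ k.J, a ≤ s → s < r → r ≤ s' →
          k.Same (f a) (g r) := by
        intro k hk a ha r hr has hsr hrs
        have hsJ : s ∈ k.J := k.hJo.out ha hr ⟨has, hsr.le⟩
        have h1 := hfc k hk a ⟨ha, has⟩ s ⟨hsJ, mem_Iic.2 le_rfl⟩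
        have h2 := hgc k hk s ⟨hsJ, hs⟩ r ⟨hr, hNr r hsr hrs⟩
        rw [hgs] at h2
        have h3 := k.hc s hsJ (hf s)
        unfold SelCon.Same at *
        simp only [mem_union] at h3
        tauto
      refine ⟨fun r => if r ≤ s then f r else g r, ?_, ?_, ?_⟩
      · intro r
        dsimp only
        split_ifs
        exacts [hf r, hg r]
      · have : (0 : unitInterval) ≤ s := bot_le
        simp [this, hf0]
      · rintro k hk a ⟨haJ, ha⟩ r ⟨hrJ, hr⟩
        dsimp only
        split_ifs with h1 h2 h2
        · exact hfc k hk a ⟨haJ, h1⟩ r ⟨hrJ, h2⟩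
        · exact mixed k hk a haJ r hrJ h1 (not_le.1 h2) hr
        · have := mixed k hk r hrJ a haJ h2 (not_le.1 h1) ha
          unfold SelCon.Same at *
          tauto
        · exact hgc k hk a ⟨haJ, hNr a (not_le.1 h1) ha⟩ r ⟨hrJ, hNr r (not_le.1 h2) hr⟩
  have hclopen : IsClopen P := by
    constructor
    · rw [← isOpen_compl_iff, isOpen_iff_mem_nhds]
      intro t ht
      obtain ⟨N, hN, h⟩ := key t
      exact Filter.mem_of_superset hN fun s hs hsP => ht (h s hs t (mem_of_mem_nhds hN) hsP)
    · rw [isOpen_iff_mem_nhds]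
      intro t ht
      obtain ⟨N, hN, h⟩ := key t
      exact Filter.mem_of_superset hN fun s hs => h t (mem_of_mem_nhds hN) s hs ht
  have h0 : (0 : unitInterval) ∈ P := by
    have hne : ∀ r, ∃ y ∈ (α r).1, (r = 0 → y = p) := by
      intro r
      by_cases hr : r = 0
      · subst hr
        exact ⟨p, hp, fun _ => rfl⟩
      · obtain ⟨z, hz⟩ := (α r).2
        exact ⟨z, hz.2.2.2.1, fun h => absurd h hr⟩
    choose f hf hf0 using hne
    refine ⟨f, hf, hf0 0 rfl, ?_⟩
    rintro c hc a ⟨haJ, ha⟩ b ⟨hbJ, hb⟩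
    have ha0 : a = 0 := le_antisymm ha bot_le
    have hb0 : b = 0 := le_antisymm hb bot_le
    subst ha0 hb0
    have h3 := c.hc _ haJ (hf 0)
    have h4 : f 0 ∈ c.U → f 0 ∉ c.V := fun h => disjoint_left.1 c.hd h
    unfold SelCon.Same
    simp only [mem_union] at h3
    tauto
  have h1 : (1 : unitInterval) ∈ P := by
    rw [hclopen.eq_univ ⟨0, h0⟩]
    trivial
  obtain ⟨f, hf, hf0, hfc⟩ := h1
  exact ⟨f, hf, hf0, fun c hc a ha b hb => hfc c hc a ⟨ha, mem_Iic.2 le_top⟩ b ⟨hb, mem_Iic.2 le_top⟩⟩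

lemma sel_all [T2Space X] (α : unitInterval → Sc X) (hα : Continuous α)
    (p : X) (hp : p ∈ (α 0).1) :
    ∃ f : unitInterval → X, (∀ r, f r ∈ (α r).1) ∧ f 0 = p ∧
        ∀ c : SelCon α, ∀ a ∈ c.J, ∀ b ∈ c.J, c.Same (f a) (f b) := by
  have hK : IsCompact (pi univ (fun t => (α t).1) ∩ {f | f 0 = p}) := by
    refine IsCompact.inter_right (isCompact_univ_pi fun t => ?_) ?_
    · obtain ⟨x, hx⟩ := (α t).2
      exact ncs_compact hx
    · exact isClosed_singleton.preimage (continuous_apply (0 : unitInterval))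
  obtain ⟨f, ⟨hf, hf0⟩, hfc⟩ := hK.inter_iInter_nonempty
    (fun c : SelCon α => {f | ∀ a ∈ c.J, ∀ b ∈ c.J, c.Same (f a) (f b)}) (by
      intro c
      simp only [ofPred_forall, SelCon.Same]
      refine isClosed_iInter fun a => isClosed_iInter fun _ => isClosed_iInter fun b =>
        isClosed_iInter fun _ => ?_
      have h : ∀ (O : Set X), IsOpen O → ∀ a : unitInterval,
          IsClosed {f : unitInterval → X | f a ∉ O} := fun O hO a =>
        IsClosed.preimage (f := fun f : unitInterval → X => f a) (continuous_apply a)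
          hO.isClosed_compl
      exact ((h _ c.hV a).inter (h _ c.hV b)).union ((h _ c.hU a).inter (h _ c.hU b))) (by
      intro u
      obtain ⟨f, hf, hf0, hfc⟩ := sel_finite α hα u p hp
      exact ⟨f, ⟨fun r _ => hf r, hf0⟩, mem_iInter₂.2 hfc⟩)
  exact ⟨f, fun r => hf r trivial, hf0, fun c => mem_iInter.1 hfc c⟩

end Helpers

/-- If `α : [0,1] → S_c(X)` is continuous and `p ∈ α(0)`, then there is a continuous
`f : [0,1] → X` with `f(0) = p` and `f(t) ∈ α(t)` for all `t`. -/
theorem stmt_13 {X : Type*} [TopologicalSpace X] [T2Space X] [Infinite X]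
    [FrechetUrysohnSpace X] (hnd : ¬ DiscreteTopology X)
    (α : unitInterval → Sc X) (hα : Continuous α) (p : X) (hp : p ∈ (α 0).1) :
    ∃ f : unitInterval → X, Continuous f ∧ f 0 = p ∧ ∀ t, f t ∈ (α t).1 := by
  obtain ⟨f, hf, hf0, hfc⟩ := sel_all α hα p hp
  refine ⟨f, ?_, hf0, hf⟩
  rw [continuous_iff_continuousAt]
  intro t
  rw [ContinuousAt, (nhds_basis_opens (f t)).tendsto_right_iff]
  rintro W ⟨hfW, hW⟩
  obtain ⟨x, hx⟩ := (α t).2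
  obtain ⟨U, V, hU, hV, hd, hSUV, hfU, hUW⟩ := ncs_split hx (f t) (hf t) W hW hfW
  obtain ⟨b, c, htbc, hbc, hsub⟩ :=
    exists_Icc_mem_subset_of_mem_nhds (sc_usc α hα t _ (hU.union hV) hSUV)
  let k : SelCon α := ⟨Icc b c, U, V, isClosed_Icc, ordConnected_Icc, hU, hV, hd,
    fun s hs => hsub hs⟩
  filter_upwards [hbc] with s hs
  apply hUW
  rcases hfc k t htbc s hs with h | h
  · exact (hsub hs (hf s)).resolve_right h.2
  · exact absurd hfU h.1
end

section
/- Let X be a Hausdorff space. If the hyperspace S_c(X) of nontrivial convergent sequences of X is nonempty and path-wise connected, then X is path-wise connected. -/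
open Set Topology

open Filter in
theorem ncs_isol {X : Type*} [TopologicalSpace X] [T2Space X] {S : Set X} {x : X}
    (h : ∀ U : Set X, IsOpen U → x ∈ U → (S \ U).Finite) (y : X) (hy : y ≠ x) :
    ∃ U : Set X, IsOpen U ∧ y ∈ U ∧ U ∩ S ⊆ {y} := by
  obtain ⟨W, V, hW, hV, hyW, hxV, hd⟩ := t2_separation hy
  have hf := h V hV hxV
  refine ⟨W \ ((S \ V) \ {y}), hW.sdiff (hf.subset diff_subset).isClosed, ⟨hyW, by simp⟩, ?_⟩
  rintro z ⟨⟨hzW, hz⟩, hzS⟩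
  by_contra hne
  exact hz ⟨⟨hzS, fun hzV => Set.disjoint_left.1 hd hzW hzV⟩, hne⟩

theorem mkNCS {X : Type*} [TopologicalSpace X] [T2Space X] {S : Set X} {x : X}
    (hi : S.Infinite) (hc : S.Countable) (hx : x ∈ S)
    (h : ∀ U : Set X, IsOpen U → x ∈ U → (S \ U).Finite) : IsNCS S x := by
  refine ⟨hi, hc, ?_, hx, ?_, ?_, h⟩
  · rw [← isOpen_compl_iff, isOpen_iff_forall_mem_open]
    intro y hy
    obtain ⟨U, hU, hyU, hs⟩ := ncs_isol h y (fun e => hy (e ▸ hx))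
    refine ⟨U, fun z hz hzS => ?_, hU, hyU⟩
    have : z = y := hs ⟨hz, hzS⟩
    exact hy (this ▸ hzS)
  · rintro ⟨U, hU, hUS⟩
    have hxU : x ∈ U := by
      have : x ∈ U ∩ S := by rw [hUS]; rfl
      exact this.1
    apply hi
    refine ((h U hU hxU).union (finite_singleton x)).subset ?_
    intro z hz
    by_cases hzU : z ∈ U
    · right
      rw [← hUS]
      exact ⟨hzU, hz⟩
    · exact Or.inl ⟨hz, hzU⟩
  · intro y hy hne
    obtain ⟨U, hU, hyU, hs⟩ := ncs_isol h y hne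
    refine ⟨U, hU, Subset.antisymm hs ?_⟩
    rintro _ rfl
    exact ⟨hyU, hy⟩

theorem IsNCS.compact {X : Type*} [TopologicalSpace X] {S : Set X} {x : X}
    (h : IsNCS S x) : IsCompact S := by
  obtain ⟨-, -, -, hx, -, -, hf⟩ := h
  rw [isCompact_iff_ultrafilter_le_nhds]
  intro f hfS
  by_cases hle : (f : Filter X) ≤ 𝓝 x
  · exact ⟨x, hx, hle⟩
  · have : ∃ U, IsOpen U ∧ x ∈ U ∧ U ∉ f := by
      by_contra! hcon
      apply hle
      intro s hs
      obtain ⟨U, hUs, hU, hxU⟩ := mem_nhds_iff.1 hs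
      exact Filter.mem_of_superset (hcon U hU hxU) hUs
    obtain ⟨U, hU, hxU, hUf⟩ := this
    have hSU : S \ U ∈ f := Filter.inter_mem (by simpa using hfS) (Ultrafilter.compl_mem_iff_notMem.2 hUf)
    obtain ⟨y, hy, rfl⟩ := Ultrafilter.eq_pure_of_finite_mem (hf U hU hxU) hSU
    exact ⟨y, hy.1, by simpa using pure_le_nhds y⟩

/-- separation of a point inside a convergent sequence -/
theorem IsNCS.sep {X : Type*} [TopologicalSpace X] [T2Space X] {S : Set X} {x y : X}
    (h : IsNCS S x) (hy : y ∈ S) {U : Set X} (hU : IsOpen U) (hyU : y ∈ U) :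
    ∃ V W : Set X, IsOpen V ∧ IsOpen W ∧ Disjoint V W ∧ y ∈ V ∧ V ⊆ U ∧ S ⊆ V ∪ W := by
  have hS := h.compact
  have key : ∃ O : Set X, IsOpen O ∧ y ∈ O ∧ O ⊆ U ∧ IsClosed (S ∩ O) := by
    by_cases hxy : y = x
    · subst hxy
      refine ⟨U, hU, hyU, Subset.rfl, ?_⟩
      rw [← isOpen_compl_iff, isOpen_iff_forall_mem_open]
      intro z hz
      by_cases hzS : z ∈ S
      · have hne : z ≠ y := fun e => hz (e ▸ ⟨hy, hyU⟩)
        obtain ⟨P, hP, hPS⟩ := h.2.2.2.2.2.1 z hzS hne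
        refine ⟨P, ?_, hP, ?_⟩
        · rintro w hw ⟨hwS, hwU⟩
          have : w ∈ ({z} : Set X) := hPS ▸ ⟨hw, hwS⟩
          rw [mem_singleton_iff] at this
          subst this
          exact hz ⟨hwS, hwU⟩
        · have : z ∈ P ∩ S := by rw [hPS]; rfl
          exact this.1
      · exact ⟨Sᶜ, fun w hw hw' => hw hw'.1, h.2.2.1.isOpen_compl, hzS⟩
    · obtain ⟨P, hP, hPS⟩ := h.2.2.2.2.2.1 y hy hxy
      have hyP : y ∈ P ∩ S := by rw [hPS]; rfl
      refine ⟨P ∩ U, hP.inter hU, ⟨hyP.1, hyU⟩, inter_subset_right, ?_⟩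
      have : S ∩ (P ∩ U) = {y} := by
        apply Subset.antisymm
        · rintro w ⟨h1, h2, h3⟩
          rw [← hPS]
          exact ⟨h2, h1⟩
        · rintro _ rfl
          exact ⟨hy, hyP.1, hyU⟩
      rw [this]
      exact isClosed_singleton
  obtain ⟨O, hO, hyO, hOU, hcl⟩ := key
  have c1 : IsCompact (S ∩ O) := hS.of_isClosed_subset hcl inter_subset_left
  have c2 : IsCompact (S \ O) := hS.diff hO
  obtain ⟨V, W, hV, hW, h1, h2, hd⟩ := SeparatedNhds.of_isCompact_isCompact c1 c2
    (Set.disjoint_left.2 fun z hz hz' => hz'.2 hz.2)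
  refine ⟨V ∩ U, W, hV.inter hU, hW, hd.mono_left inter_subset_left, ⟨h1 ⟨hy, hyO⟩, hyU⟩,
    inter_subset_right, ?_⟩
  intro z hz
  by_cases hzO : z ∈ O
  · exact Or.inl ⟨h1 ⟨hz, hzO⟩, hOU hzO⟩
  · exact Or.inr (h2 ⟨hz, hzO⟩)

def GG {X : Type*} (F : ℝ → Set X) (a b : ℝ) : Set (ℝ × X) :=
  {p | a ≤ p.1 ∧ p.1 ≤ b ∧ p.2 ∈ F p.1}

def LC {X : Type*} [TopologicalSpace X] (F : ℝ → Set X) (a b : ℝ) (φ : ℝ × X → Prop) : Prop :=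
  ∀ p ∈ GG F a b, ∀ᶠ q in 𝓝[GG F a b] p, (φ q ↔ φ p)

def RR {X : Type*} [TopologicalSpace X] (F : ℝ → Set X) (a : ℝ) (x : X) (b : ℝ) (y : X) : Prop :=
  ∀ φ, LC F a b φ → φ (a, x) → φ (b, y)

theorem GG_mono {X : Type*} (F : ℝ → Set X) {a b c d : ℝ} (h : c ≤ a) (h' : b ≤ d) :
    GG F a b ⊆ GG F c d := fun _ hp => ⟨h.trans hp.1, hp.2.1.trans h', hp.2.2⟩

theorem LC.mono {X : Type*} [TopologicalSpace X] {F : ℝ → Set X} {a b c d : ℝ} {φ}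
    (hl : LC F c d φ) (h : c ≤ a) (h' : b ≤ d) : LC F a b φ := fun p hp =>
  (hl p (GG_mono F h h' hp)).filter_mono (nhdsWithin_mono _ (GG_mono F h h'))

theorem LC.fib {X : Type*} [TopologicalSpace X] {F : ℝ → Set X} {a b c : ℝ} {φ}
    (hl : LC F a b φ) (h : a ≤ c) (h' : c ≤ b) {x : X} (hx : x ∈ F c) :
    ∀ᶠ y in 𝓝[F c] x, (φ (c, y) ↔ φ (c, x)) := by
  have ht : Filter.Tendsto (fun y => (c, y)) (𝓝[F c] x) (𝓝[GG F a b] (c, x)) := by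
    apply tendsto_nhdsWithin_of_tendsto_nhds_of_eventually_within
    · exact (Continuous.prodMk_right c).continuousAt.tendsto.mono_left nhdsWithin_le_nhds
    · filter_upwards [self_mem_nhdsWithin] with y hy
      exact ⟨h, h', hy⟩
  exact ht.eventually (hl (c, x) ⟨h, h', hx⟩)

theorem RR.trans {X : Type*} [TopologicalSpace X] {F : ℝ → Set X} {a b c : ℝ} {x y z : X}
    (hab : a ≤ b) (hbc : b ≤ c) (h1 : RR F a x b y) (h2 : RR F b y c z) : RR F a x c z :=
  fun φ hφ hx => h2 φ (hφ.mono hab le_rfl) (h1 φ (hφ.mono le_rfl hbc) hx)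

theorem RR_exists {X : Type*} [TopologicalSpace X] {F : ℝ → Set X}
    (hc : ∀ t, IsCompact (F t))
    (usc : ∀ U : Set X, IsOpen U → IsOpen {t | F t ⊆ U})
    (lsc : ∀ U : Set X, IsOpen U → IsOpen {t | (F t ∩ U).Nonempty})
    {a b : ℝ} (hab : a ≤ b) {x : X} (hx : x ∈ F a) : ∃ y ∈ F b, RR F a x b y := by
  by_contra! hcon
  have key : ∃ φ, LC F a b φ ∧ φ (a, x) ∧ ∀ y ∈ F b, ¬ φ (b, y) := by
    refine (hc b).induction_on (p := fun s => ∃ φ, LC F a b φ ∧ φ (a, x) ∧ ∀ y ∈ s, ¬ φ (b, y))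
      ⟨fun _ => True, fun _ _ => by simp, trivial, by simp⟩ ?_ ?_ ?_
    · rintro s t hst ⟨φ, h1, h2, h3⟩
      exact ⟨φ, h1, h2, fun y hy => h3 y (hst hy)⟩
    · rintro s t ⟨φ, h1, h2, h3⟩ ⟨ψ, k1, k2, k3⟩
      refine ⟨fun p => φ p ∧ ψ p, fun p hp => ?_, ⟨h2, k2⟩, ?_⟩
      · filter_upwards [h1 p hp, k1 p hp] with q e1 e2
        rw [e1, e2]
      · rintro y (hy | hy) ⟨e1, e2⟩
        · exact h3 y hy e1
        · exact k3 y hy e2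
    · intro y hy
      have := hcon y hy
      unfold RR at this
      push Not at this
      obtain ⟨φ, h1, h2, h3⟩ := this
      refine ⟨_, h1.fib hab le_rfl hy, φ, h1, h2, ?_⟩
      intro z hz hz'
      exact h3 (hz.1 hz')
  obtain ⟨φ, hφ, hφa, hφb⟩ := key
  let ψ : ℝ → Prop := fun t => ∃ z ∈ F t, φ (t, z)
  have main : ∀ t ∈ Icc a b, ∀ᶠ t' in 𝓝[Icc a b] t, (ψ t ↔ ψ t') := by
    intro t ht
    by_cases hψ : ψ t
    · obtain ⟨z, hz, hφz⟩ := hψ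
      have h1 := hφ (t, z) ⟨ht.1, ht.2, hz⟩
      rw [eventually_nhdsWithin_iff, nhds_prod_eq, Filter.eventually_prod_iff] at h1
      obtain ⟨pa, hpa, pb, hpb, hh⟩ := h1
      obtain ⟨U, hUs, hU, hzU⟩ := mem_nhds_iff.1 hpb
      have h2 : ∀ᶠ t' in 𝓝 t, (F t' ∩ U).Nonempty := (lsc U hU).mem_nhds ⟨z, hz, hzU⟩
      filter_upwards [self_mem_nhdsWithin, nhdsWithin_le_nhds hpa, nhdsWithin_le_nhds h2]
        with t' m1 m2 m3
      obtain ⟨w, hw, hwU⟩ := m3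
      have := (hh m2 (hUs hwU) ⟨m1.1, m1.2, hw⟩).2 hφz
      exact ⟨fun _ => ⟨w, hw, this⟩, fun _ => ⟨z, hz, hφz⟩⟩
    · have : ∃ U, IsOpen U ∧ F t ⊆ U ∧
          ∀ᶠ t' in 𝓝 t, ∀ z ∈ U, (t', z) ∈ GG F a b → ¬ φ (t', z) := by
        refine (hc t).induction_on (p := fun s => ∃ U, IsOpen U ∧ s ⊆ U ∧
          ∀ᶠ t' in 𝓝 t, ∀ z ∈ U, (t', z) ∈ GG F a b → ¬ φ (t', z))
          ⟨∅, isOpen_empty, Subset.rfl, by simp⟩ ?_ ?_ ?_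
        · rintro s s' hs ⟨U, h1, h2, h3⟩
          exact ⟨U, h1, hs.trans h2, h3⟩
        · rintro s s' ⟨U, h1, h2, h3⟩ ⟨U', k1, k2, k3⟩
          refine ⟨U ∪ U', h1.union k1, union_subset_union h2 k2, ?_⟩
          filter_upwards [h3, k3] with t' e1 e2
          rintro z (hz | hz)
          · exact e1 z hz
          · exact e2 z hz
        · intro z hz
          have hnz : ¬ φ (t, z) := fun h => hψ ⟨z, hz, h⟩
          have h1 := hφ (t, z) ⟨ht.1, ht.2, hz⟩
          rw [eventually_nhdsWithin_iff, nhds_prod_eq, Filter.eventually_prod_iff] at h1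
          obtain ⟨pa, hpa, pb, hpb, hh⟩ := h1
          obtain ⟨U, hUs, hU, hzU⟩ := mem_nhds_iff.1 hpb
          refine ⟨U, nhdsWithin_le_nhds (hU.mem_nhds hzU), U, hU, Subset.rfl, ?_⟩
          filter_upwards [hpa] with t' m w hw hG hφw
          exact hnz ((hh m (hUs hw) hG).1 hφw)
      obtain ⟨U, hU, hFU, hev⟩ := this
      have h2 : ∀ᶠ t' in 𝓝 t, F t' ⊆ U := (usc U hU).mem_nhds hFU
      filter_upwards [self_mem_nhdsWithin, nhdsWithin_le_nhds hev, nhdsWithin_le_nhds h2]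
        with t' m1 m2 m3
      refine ⟨fun h => absurd h hψ, ?_⟩
      rintro ⟨w, hw, hφw⟩
      exact absurd hφw (m2 w (m3 hw) ⟨m1.1, m1.2, hw⟩)
  have := isPreconnected_Icc.induction₂ (fun t t' => (ψ t ↔ ψ t')) main
    (fun x y z _ _ _ h1 h2 => h1.trans h2) (fun x y _ _ h => h.symm)
    (left_mem_Icc.2 hab) (right_mem_Icc.2 hab)
  obtain ⟨y, hy, hφy⟩ := this.1 ⟨x, hx, hφa⟩
  exact hφb y hy hφy

theorem RR_finite {X : Type*} [TopologicalSpace X] {F : ℝ → Set X}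
    (hc : ∀ t, IsCompact (F t)) (hne : ∀ t, (F t).Nonempty)
    (usc : ∀ U : Set X, IsOpen U → IsOpen {t | F t ⊆ U})
    (lsc : ∀ U : Set X, IsOpen U → IsOpen {t | (F t ∩ U).Nonempty})
    {x : X} (hx : x ∈ F 0) (T : Finset ℝ) :
    ∃ s : ℝ → X, (∀ t, s t ∈ F t) ∧ s 0 = x ∧
      ∀ a ∈ insert 0 T, ∀ b ∈ insert 0 T, 0 ≤ a → a ≤ b → RR F a (s a) b (s b) := by
  classical
  induction T using Finset.induction_on_max with
  | empty =>
    choose s hs using hne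
    refine ⟨Function.update s 0 x, ?_, by simp, ?_⟩
    · intro t
      by_cases h : t = 0
      · subst h; simpa using hx
      · simpa [h] using hs t
    · intro a ha b hb _ _
      simp at ha hb
      subst ha hb
      intro φ _ h
      exact h
  | insert m T hm ih =>
    obtain ⟨s, hs, hs0, hR⟩ := ih
    by_cases hm0 : m ≤ 0
    · refine ⟨s, hs, hs0, ?_⟩
      intro a ha b hb h0 hab
      have aux : ∀ c ∈ insert 0 (insert m T), 0 ≤ c → c ∈ insert 0 T := by
        intro c hc hc0
        simp only [Finset.mem_insert] at hc ⊢
        rcases hc with h | h | h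
        · exact Or.inl h
        · left; linarith
        · exact Or.inr h
      exact hR a (aux a ha h0) b (aux b hb (h0.trans hab)) h0 hab
    · push Not at hm0
      have hlt : ∀ c ∈ insert 0 T, c < m := by
        intro c hc
        rcases Finset.mem_insert.1 hc with h | h
        · rw [h]; exact hm0
        · exact hm c h
      obtain ⟨M, hM, hMmax⟩ := (insert 0 T).exists_max_image id (Finset.insert_nonempty 0 T)
      obtain ⟨y, hy, hRy⟩ := RR_exists hc usc lsc (hlt M hM).le (hs M)
      refine ⟨Function.update s m y, ?_, ?_, ?_⟩
      · intro t
        by_cases h : t = m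
        · subst h; simpa using hy
        · simpa [h] using hs t
      · simpa [hm0.ne] using hs0
      · intro a ha b hb h0 hab
        rw [Finset.insert_comm] at ha hb
        rcases Finset.mem_insert.1 ha with rfl | ha1
        · rcases Finset.mem_insert.1 hb with rfl | hb
          · intro φ _ h
            exact h
          · exact absurd (hlt b hb) (not_lt.2 hab)
        · have ham := (hlt a ha1).ne
          rcases Finset.mem_insert.1 hb with rfl | hb
          · simp only [Function.update_self, Function.update_of_ne ham]
            exact RR.trans (hMmax a ha1) (hlt M hM).le (hR a ha1 M hM h0 (hMmax a ha1)) hRy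
          · simp only [Function.update_of_ne ham, Function.update_of_ne (hlt b hb).ne]
            exact hR a ha1 b hb h0 hab

theorem RR_all {X : Type*} [TopologicalSpace X] {F : ℝ → Set X}
    (hc : ∀ t, IsCompact (F t)) (hne : ∀ t, (F t).Nonempty)
    (usc : ∀ U : Set X, IsOpen U → IsOpen {t | F t ⊆ U})
    (lsc : ∀ U : Set X, IsOpen U → IsOpen {t | (F t ∩ U).Nonempty})
    {x : X} (hx : x ∈ F 0) :
    ∃ s : ℝ → X, (∀ t, s t ∈ F t) ∧ s 0 = x ∧
      ∀ a b, 0 ≤ a → a ≤ b → RR F a (s a) b (s b) := by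
  classical
  choose S hS hS0 hR using RR_finite hc hne usc lsc hx
  let f : Ultrafilter (Finset ℝ) := Ultrafilter.of Filter.atTop
  have hf : (f : Filter (Finset ℝ)) ≤ Filter.atTop := Ultrafilter.of_le _
  have hlim : ∀ t, ∃ y ∈ F t, Filter.Tendsto (fun T => S T t) f (𝓝 y) := by
    intro t
    obtain ⟨y, hy, hle⟩ := isCompact_iff_ultrafilter_le_nhds.1 (hc t) (f.map (fun T => S T t))
      (by
        rw [Filter.le_principal_iff]
        exact Filter.mem_map.2 (Filter.univ_mem' fun T => hS T t))
    exact ⟨y, hy, hle⟩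
  choose s hs hts using hlim
  have hw : ∀ t, Filter.Tendsto (fun T => S T t) f (𝓝[F t] (s t)) := fun t =>
    tendsto_nhdsWithin_of_tendsto_nhds_of_eventually_within _ (hts t)
      (Filter.Eventually.of_forall fun T => hS T t)
  have hRs : ∀ a b, 0 ≤ a → a ≤ b → RR F a (s a) b (s b) := by
    intro a b h0 hab φ hφ ha
    have e1 := (hw a).eventually (hφ.fib le_rfl hab (hs a))
    have e2 := (hw b).eventually (hφ.fib hab le_rfl (hs b))
    have e3 : ∀ᶠ T in (f : Filter (Finset ℝ)), ({a, b} : Finset ℝ) ≤ T :=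
      hf (Filter.eventually_ge_atTop _)
    obtain ⟨T, h1, h2, h3⟩ := (e1.and (e2.and e3)).exists
    have haT : a ∈ insert 0 T := Finset.mem_insert_of_mem (h3 (by simp))
    have hbT : b ∈ insert 0 T := Finset.mem_insert_of_mem (h3 (by simp))
    exact h2.1 (hR T a haT b hbT h0 hab φ hφ (h1.2 ha))
  refine ⟨Function.update s 0 x, ?_, by simp, ?_⟩
  · intro t
    by_cases h : t = 0
    · subst h; simpa using hx
    · simpa [h] using hs t
  · intro a b h0 hab φ hφ
    have hz : ∀ t, ∀ᶠ T in (f : Filter (Finset ℝ)), a ≤ t → t ≤ b →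
        (φ (t, S T t) ↔ φ (t, Function.update s 0 x t)) := by
      intro t
      by_cases h : t = 0
      · subst h
        refine Filter.Eventually.of_forall fun T _ _ => ?_
        simp [hS0]
      · by_cases h' : a ≤ t ∧ t ≤ b
        · filter_upwards [(hw t).eventually (hφ.fib h'.1 h'.2 (hs t))] with T hT _ _
          simpa [h] using hT
        · exact Filter.Eventually.of_forall fun T h1 h2 => absurd ⟨h1, h2⟩ h'
    have e3 : ∀ᶠ T in (f : Filter (Finset ℝ)), ({a, b} : Finset ℝ) ≤ T :=
      hf (Filter.eventually_ge_atTop _)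
    obtain ⟨T, h1, h2, h3⟩ := ((hz a).and ((hz b).and e3)).exists
    have haT : a ∈ insert 0 T := Finset.mem_insert_of_mem (h3 (by simp))
    have hbT : b ∈ insert 0 T := Finset.mem_insert_of_mem (h3 (by simp))
    intro ha
    exact (h2 hab le_rfl).1 (hR T a haT b hbT h0 hab φ hφ ((h1 le_rfl hab).2 ha))

theorem selection {X : Type*} [TopologicalSpace X] [T2Space X] {F : ℝ → Set X}
    (hn : ∀ t, ∃ x, IsNCS (F t) x)
    (usc : ∀ U : Set X, IsOpen U → IsOpen {t | F t ⊆ U})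
    (lsc : ∀ U : Set X, IsOpen U → IsOpen {t | (F t ∩ U).Nonempty})
    {x : X} (hx : x ∈ F 0) : ∃ y ∈ F 1, Joined x y := by
  have hc : ∀ t, IsCompact (F t) := fun t => (hn t).choose_spec.compact
  have hne : ∀ t, (F t).Nonempty := fun t => (hn t).choose_spec.1.nonempty
  obtain ⟨s, hs, hs0, hR⟩ := RR_all hc hne usc lsc hx
  refine ⟨s 1, hs 1, ?_⟩
  have hcont : ContinuousOn s unitInterval := by
    intro t0 ht0
    obtain ⟨x0, hx0⟩ := hn t0
    rw [ContinuousWithinAt, tendsto_nhds]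
    intro U hU hsU
    obtain ⟨V, W, hV, hW, hd, hsV, hVU, hcov⟩ := hx0.sep (hs t0) hU hsU
    have hopen := usc _ (hV.union hW)
    obtain ⟨ε, hε, hball⟩ := Metric.isOpen_iff.1 hopen t0 hcov
    have hLC : ∀ a b, a ∈ Metric.ball t0 ε → b ∈ Metric.ball t0 ε →
        LC F a b (fun p => p.2 ∈ V) := by
      intro a b ha hb p hp
      have hpt : p.1 ∈ Metric.ball t0 ε := by
        rw [Real.ball_eq_Ioo] at *
        exact ⟨ha.1.trans_le hp.1, hp.2.1.trans_lt hb.2⟩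
      rcases hball hpt hp.2.2 with h | h
      · filter_upwards [nhdsWithin_le_nhds ((hV.preimage continuous_snd).mem_nhds h)] with q hq
        exact ⟨fun _ => h, fun _ => hq⟩
      · filter_upwards [nhdsWithin_le_nhds ((hW.preimage continuous_snd).mem_nhds h)] with q hq
        exact ⟨fun h' => (Set.disjoint_left.1 hd h' hq).elim,
          fun h' => (Set.disjoint_left.1 hd h' h).elim⟩
    filter_upwards [self_mem_nhdsWithin, nhdsWithin_le_nhds (Metric.ball_mem_nhds t0 hε)]
      with t ht htb
    apply hVU
    rcases le_total t0 t with hle | hle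
    · exact hR t0 t ht0.1 hle _ (hLC t0 t (Metric.mem_ball_self hε) htb) hsV
    · by_contra hnV
      have hl : LC F t t0 (fun p => ¬ p.2 ∈ V) := fun p hp => by
        filter_upwards [hLC t t0 htb (Metric.mem_ball_self hε) p hp] with q hq
        rw [hq]
      exact hR t t0 ht.1 hle _ hl hnV hsV
  exact (JoinedIn.ofLine (F := univ) hcont hs0 rfl (subset_univ _)).joined

theorem claimA {X : Type*} [TopologicalSpace X] [T2Space X]
    (hpc : PathConnectedSpace (Sc X)) {S : Set X} {x : X} (hS : IsNCS S x) (p : X) :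
    ∃ y ∈ S, Joined p y := by
  have hS' : IsNCS (insert p S) x := by
    refine mkNCS (hS.1.mono (subset_insert _ _)) (hS.2.1.insert p)
      (mem_insert_of_mem _ hS.2.2.2.1) ?_
    intro U hU hxU
    refine ((hS.2.2.2.2.2.2 U hU hxU).insert p).subset ?_
    rintro z ⟨rfl | hz, hzU⟩
    · exact mem_insert _ _
    · exact mem_insert_of_mem _ ⟨hz, hzU⟩
  let A : Sc X := ⟨insert p S, x, hS'⟩
  let B : Sc X := ⟨S, x, hS⟩
  obtain ⟨γ⟩ := PathConnectedSpace.joined A B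
  have hco : @Continuous ℝ (Set X) _ (vietorisTopology X) (fun t => (γ.extend t).1) := by
    letI := vietorisTopology X
    have h1 : Continuous (fun S : Sc X => S.1) := continuous_induced_dom
    exact h1.comp γ.continuous_extend
  have e0 : (γ.extend 0).1 = insert p S := by rw [γ.extend_zero]
  have e1 : (γ.extend 1).1 = S := by rw [γ.extend_one]
  have h := selection (F := fun t => (γ.extend t).1) (fun t => (γ.extend t).2)
    (fun U hU => by
      letI := vietorisTopology X
      exact (TopologicalSpace.isOpen_generateFrom_of_mem (Or.inl ⟨U, hU, rfl⟩)).preimage hco)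
    (fun U hU => by
      letI := vietorisTopology X
      exact (TopologicalSpace.isOpen_generateFrom_of_mem (Or.inr ⟨U, hU, rfl⟩)).preimage hco)
    (x := p) (by
      change p ∈ (γ.extend 0).1
      rw [e0]
      exact mem_insert _ _)
  obtain ⟨y, hy, hj⟩ := h
  exact ⟨y, e1 ▸ hy, hj⟩

theorem claimB {X : Type*} [TopologicalSpace X] [T2Space X] {u v : X} (huv : u ≠ v)
    (h : Joined u v) : ∃ T x, IsNCS T x ∧ ∀ w ∈ T, Joined u w := by
  obtain ⟨γ⟩ := h
  have hj : ∀ t, Joined u (γ t) := fun t => by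
    have hp : IsPathConnected (unitInterval) :=
      (convex_Icc (0 : ℝ) 1).isPathConnected ⟨0, by simp⟩
    have h2 := hp.image γ.continuous_extend
    have h3 := (h2.joinedIn _ ⟨0, by simp, rfl⟩ _ ⟨t.1, t.2, rfl⟩).joined
    simpa using h3
  have hinf : (range γ).Infinite := by
    have hp : IsPreconnected (range γ) := isPreconnected_range γ.continuous
    exact hp.infinite_of_nontrivial ⟨u, ⟨0, γ.source⟩, v, ⟨1, γ.target⟩, huv⟩
  let e := hinf.natEmbedding
  choose t ht using fun n => (e n).2
  obtain ⟨a, -, φ, hφ, hlim⟩ := isCompact_univ.tendsto_subseq (x := t) (fun n => mem_univ _)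
  have hinj : Function.Injective (fun n => γ (t (φ n))) := by
    intro m n hmn
    simp only [ht] at hmn
    exact hφ.injective (e.injective (Subtype.ext hmn))
  have hl : Filter.Tendsto (fun n => γ (t (φ n))) Filter.atTop (𝓝 (γ a)) :=
    (γ.continuous.tendsto a).comp hlim
  refine ⟨insert (γ a) (range fun n => γ (t (φ n))), γ a, mkNCS ?_ ?_ (mem_insert _ _) ?_, ?_⟩
  · exact (infinite_range_of_injective hinj).mono (subset_insert _ _)
  · exact (countable_range _).insert _
  · intro U hU ha
    have hev := hl.eventually (hU.mem_nhds ha)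
    obtain ⟨N, hN⟩ := Filter.eventually_atTop.1 hev
    refine ((finite_lt_nat N).image (fun n => γ (t (φ n)))).subset ?_
    rintro z ⟨rfl | ⟨n, rfl⟩, hz⟩
    · exact absurd ha hz
    · exact ⟨n, not_le.1 fun h => hz (hN n h), rfl⟩
  · rintro w (rfl | ⟨n, rfl⟩)
    · exact hj a
    · exact hj _

/-- If `S_c(X)` is nonempty and path-wise connected, then `X` is path-wise connected. -/
theorem stmt_14 {X : Type*} [TopologicalSpace X] [T2Space X] [Infinite X]
    [FrechetUrysohnSpace X] (hnd : ¬ DiscreteTopology X)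
    (hne : Nonempty (Sc X)) (hpc : PathConnectedSpace (Sc X)) :
    PathConnectedSpace X := by
  obtain ⟨S, x, hS⟩ := hne
  obtain ⟨y, hy, hyx⟩ := hS.1.exists_notMem_finset {x}
  simp only [Finset.mem_singleton] at hyx
  have hS' : IsNCS (S \ {y}) x := by
    refine mkNCS (hS.1.diff (finite_singleton y)) (hS.2.1.mono diff_subset)
      ⟨hS.2.2.2.1, fun h => hyx h.symm⟩ ?_
    intro U hU hxU
    exact (hS.2.2.2.2.2.2 U hU hxU).subset (diff_subset_diff_left diff_subset)
  obtain ⟨z, hz, hyz⟩ := claimA hpc hS' y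
  obtain ⟨T, w, hT, hTj⟩ := claimB (fun h => hz.2 h.symm) hyz
  have hall : ∀ p, Joined y p := fun p => by
    obtain ⟨q, hq, hpq⟩ := claimA hpc hT p
    exact (hTj q hq).trans hpq.symm
  exact ⟨⟨y⟩, fun p q => (hall p).symm.trans (hall q)⟩
end

section
/- Let f : [0,1] → S_c(X) be a continuous function and let C be a nonempty closed subset of ⋃f([0,1]) (the union in X of all sequences f(t)) such that f(t) ∩ C ≠ ∅ for some t ∈ [0,1]. If s = sup{t ∈ [0,1] : f(t) ∩ C ≠ ∅}, then f(s) ∩ C ≠ ∅. -/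
open Set Topology

/-- Supremum lemma: if `f : [0,1] → S_c(X)` is continuous, `C` is a nonempty closed
subset of `⋃ f([0,1])` meeting some `f(t)`, and `s = sup{t : f(t) ∩ C ≠ ∅}`, then
`f(s) ∩ C ≠ ∅`. -/
theorem stmt_15 {X : Type*} [TopologicalSpace X] [T2Space X] [Infinite X]
    [FrechetUrysohnSpace X] (hnd : ¬ DiscreteTopology X)
    (f : ℝ → Sc X) (hf : ContinuousOn f (Set.Icc 0 1))
    (C : Set X) (hCne : C.Nonempty)
    (hCsub : C ⊆ ⋃ t ∈ Set.Icc (0:ℝ) 1, (f t).1)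
    (hCclosed : IsClosed
      ((Subtype.val : ↥(⋃ t ∈ Set.Icc (0:ℝ) 1, (f t).1) → X) ⁻¹' C))
    (hA : ∃ t ∈ Set.Icc (0:ℝ) 1, ((f t).1 ∩ C).Nonempty)
    (s : ℝ) (hs : s = sSup {t | t ∈ Set.Icc (0:ℝ) 1 ∧ ((f t).1 ∩ C).Nonempty}) :
    ((f s).1 ∩ C).Nonempty := by
  obtain ⟨K, hK, hKC⟩ := isClosed_induced_iff.mp hCclosed
  have key : ∀ t ∈ Set.Icc (0:ℝ) 1, (((f t).1 ∩ C).Nonempty ↔ ¬ (f t).1 ⊆ Kᶜ) := by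
    intro t ht
    have h : ∀ x ∈ (f t).1, (x ∈ C ↔ x ∈ K) := by
      intro x hx
      have hxY : x ∈ ⋃ t ∈ Set.Icc (0:ℝ) 1, (f t).1 := by
        simp only [Set.mem_iUnion]
        exact ⟨t, ht, hx⟩
      have := Set.ext_iff.mp hKC ⟨x, hxY⟩
      exact this.symm
    rw [Set.not_subset]
    constructor
    · rintro ⟨x, hx, hxC⟩
      exact ⟨x, hx, fun hn => hn ((h x hx).1 hxC)⟩
    · rintro ⟨x, hx, hxK⟩
      exact ⟨x, hx, (h x hx).2 (not_not.mp hxK)⟩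
  have hopen : IsOpen {S : Sc X | S.1 ⊆ Kᶜ} := by
    refine (@isOpen_induced_iff _ _ (vietorisTopology X) _ _).mpr ⟨{F : Set X | F ⊆ Kᶜ}, ?_, rfl⟩
    exact TopologicalSpace.isOpen_generateFrom_of_mem (Or.inl ⟨Kᶜ, hK.isOpen_compl, rfl⟩)
  have hcl : IsClosed {t | t ∈ Set.Icc (0:ℝ) 1 ∧ ((f t).1 ∩ C).Nonempty} := by
    have h1 := hf.preimage_isClosed_of_isClosed isClosed_Icc hopen.isClosed_compl
    convert h1 using 1
    ext t
    exact and_congr_right (fun ht => key t ht)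
  have hmem := hcl.csSup_mem (by obtain ⟨t, ht, h⟩ := hA; exact ⟨t, ht, h⟩)
    ⟨1, fun t ht => ht.1.2⟩
  rw [← hs] at hmem
  exact hmem.2
end

section
/- Let f : [0,1] → S_c(X) be a continuous function and let C be a nonempty closed subset of ⋃f([0,1]) (the union in X of all sequences f(t)) such that f(t) ∩ C ≠ ∅ for some t ∈ [0,1]. If i = inf{t ∈ [0,1] : f(t) ∩ C ≠ ∅}, then f(i) ∩ C ≠ ∅. -/
open Set Topology

/-- Infimum lemma: if `f : [0,1] → S_c(X)` is continuous, `C` is a nonempty closed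
subset of `⋃ f([0,1])` meeting some `f(t)`, and `i = inf{t : f(t) ∩ C ≠ ∅}`, then
`f(i) ∩ C ≠ ∅`. -/
theorem stmt_16 {X : Type*} [TopologicalSpace X] [T2Space X] [Infinite X]
    [FrechetUrysohnSpace X] (hnd : ¬ DiscreteTopology X)
    (f : ℝ → Sc X) (hf : ContinuousOn f (Set.Icc 0 1))
    (C : Set X) (hCne : C.Nonempty)
    (hCsub : C ⊆ ⋃ t ∈ Set.Icc (0:ℝ) 1, (f t).1)
    (hCclosed : IsClosed
      ((Subtype.val : ↥(⋃ t ∈ Set.Icc (0:ℝ) 1, (f t).1) → X) ⁻¹' C))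
    (hA : ∃ t ∈ Set.Icc (0:ℝ) 1, ((f t).1 ∩ C).Nonempty)
    (i : ℝ) (hi : i = sInf {t | t ∈ Set.Icc (0:ℝ) 1 ∧ ((f t).1 ∩ C).Nonempty}) :
    ((f i).1 ∩ C).Nonempty := by
  obtain ⟨D, hD, hDC⟩ := isClosed_induced_iff.1 hCclosed
  have hDC' : ∀ x, x ∈ (⋃ t ∈ Set.Icc (0:ℝ) 1, (f t).1) → (x ∈ D ↔ x ∈ C) := by
    intro x hx
    have := Set.ext_iff.1 hDC ⟨x, hx⟩
    simpa using this
  have hmem : ∀ t ∈ Set.Icc (0:ℝ) 1, ∀ x ∈ (f t).1, (x ∈ D ↔ x ∈ C) := by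
    intro t ht x hx
    exact hDC' x (Set.mem_biUnion ht hx)
  set A : Set ℝ := {t | t ∈ Set.Icc (0:ℝ) 1 ∧ ((f t).1 ∩ C).Nonempty} with hAdef
  have hAne : A.Nonempty := by
    obtain ⟨t, ht, h⟩ := hA
    exact ⟨t, ht, h⟩
  have hAb : BddBelow A := ⟨0, fun t ht => ht.1.1⟩
  have hcl : i ∈ closure A := hi ▸ csInf_mem_closure hAne hAb
  have hiI : i ∈ Set.Icc (0:ℝ) 1 :=
    closure_minimal (fun t ht => ht.1) isClosed_Icc hcl
  by_contra hne
  have hsub : (f i).1 ⊆ Dᶜ := fun x hx hxD => hne ⟨x, hx, (hmem i hiI x hx).1 hxD⟩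
  have hopen : IsOpen {S : Sc X | S.1 ⊆ Dᶜ} := by
    refine (@isOpen_induced_iff _ _ (vietorisTopology X) _ _).2 ⟨{F : Set X | F ⊆ Dᶜ}, ?_, rfl⟩
    exact TopologicalSpace.isOpen_generateFrom_of_mem (Or.inl ⟨Dᶜ, hD.isOpen_compl, rfl⟩)
  have hev := (hf i hiI).eventually (hopen.mem_nhds hsub)
  obtain ⟨U, hU, hUs⟩ := mem_nhdsWithin_iff_exists_mem_nhds_inter.1 hev
  obtain ⟨t, htU, htI, x, hx, hxC⟩ := mem_closure_iff_nhds.1 hcl U hU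
  exact hUs ⟨htU, htI⟩ hx ((hmem t htI x hx).2 hxC)
end

section
/- Let X ⊆ ℝ² be the dendroid X = [u,w] ∪ ⋃_{n ∈ ℤ⁺}[u,xₙ] ∪ ⋃_{n ∈ ℤ⁻}[w,xₙ], where u = (0,1), v = (0,0), w = (0,−1), xₙ = (1/n, 0) for n ∈ ℤ \ {0}, and [x,y] denotes the straight line segment joining x and y, with the subspace topology of ℝ². For an infinite set A ⊆ ℤ⁺ let S_A = {v} ∪ {xₙ : n ∈ A ∪ ℤ⁻} ∈ S_c(X). If A and B are infinite almost disjoint subsets of ℤ⁺ (i.e. A ∩ B is finite), then there is no path in S_c(X) from S_A to S_B, i.e. no continuous map f : [0,1] → S_c(X) with f(0) = S_A and f(1) = S_B. -/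
open Set Topology

/-- The point `u = (0,1)`. -/
def uPt : ℝ × ℝ := (0, 1)
/-- The point `v = (0,0)`. -/
def vPt : ℝ × ℝ := (0, 0)
/-- The point `w = (0,-1)`. -/
def wPt : ℝ × ℝ := (0, -1)
/-- The point `xₙ = (1/n, 0)` for `n ∈ ℤ \ {0}`. -/
noncomputable def xPt (n : ℤ) : ℝ × ℝ := (1 / (n : ℝ), 0)

/-- The dendroid `X = [u,w] ∪ ⋃_{n ∈ ℤ⁺} [u,xₙ] ∪ ⋃_{n ∈ ℤ⁻} [w,xₙ] ⊆ ℝ²`,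
with the subspace topology. -/
noncomputable def dendroidX : Set (ℝ × ℝ) :=
  segment ℝ uPt wPt ∪ (⋃ n : {n : ℤ // 0 < n}, segment ℝ uPt (xPt n)) ∪
    (⋃ n : {n : ℤ // n < 0}, segment ℝ wPt (xPt n))

/-- For `A ⊆ ℤ⁺`, the set `S_A = {v} ∪ {xₙ : n ∈ A ∪ ℤ⁻}`, as a subset of the
dendroid. -/
def seqSet (A : Set ℤ) : Set ↥dendroidX :=
  {p | (p : ℝ × ℝ) = vPt ∨ ∃ n : ℤ, (n ∈ A ∨ n < 0) ∧ (p : ℝ × ℝ) = xPt n}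



/-- Set of indices of legs hit by `S` inside the strip `|y| < e`. -/
def legSet (S : Set ↥dendroidX) (e : ℝ) : Set ℤ :=
  {n | ∃ p ∈ S, |p.1.2| < e ∧ p.1.1 * n = 1 - |p.1.2|}

/-- A leg inside the strip `|y| < e`. -/
def legPart (e : ℝ) (n : ℤ) : Set ↥dendroidX :=
  {p | |p.1.2| < e ∧ p.1.1 * n = 1 - |p.1.2|}

lemma dend_mem (p : ↥dendroidX) :
    p.1.1 = 0 ∨ ∃ m : ℤ, m ≠ 0 ∧ p.1.1 * m = 1 - |p.1.2| ∧ (0 < m → 0 ≤ p.1.2) ∧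
      (m < 0 → p.1.2 ≤ 0) := by
  obtain ⟨⟨x, y⟩, hp⟩ := p
  rcases hp with (hp | hp) | hp
  · left
    obtain ⟨a, b, ha, hb, hab, h⟩ := hp
    simp [uPt, wPt, Prod.ext_iff] at h
    exact h.1.symm
  · right
    simp only [mem_iUnion] at hp
    obtain ⟨⟨n, hn⟩, a, b, ha, hb, hab, h⟩ := hp
    have hn' : (n : ℝ) ≠ 0 := by exact_mod_cast hn.ne'
    simp [uPt, xPt, Prod.ext_iff] at h
    obtain ⟨h1, h2⟩ := h
    refine ⟨n, hn.ne', ?_, fun _ => ?_, fun h => absurd h (by omega)⟩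
    · subst h1 h2
      simp only [abs_of_nonneg ha]
      field_simp
      linarith
    · simp only; linarith
  · right
    simp only [mem_iUnion] at hp
    obtain ⟨⟨n, hn⟩, a, b, ha, hb, hab, h⟩ := hp
    have hn' : (n : ℝ) ≠ 0 := by exact_mod_cast hn.ne
    simp [wPt, xPt, Prod.ext_iff] at h
    obtain ⟨h1, h2⟩ := h
    refine ⟨n, hn.ne, ?_, fun h => absurd h (by omega), fun _ => ?_⟩
    · subst h1 h2
      simp only [abs_neg, abs_of_nonneg ha]
      field_simp
      linarith
    · simp only; linarith

lemma leg_unique {x c : ℝ} {m n : ℤ} (hc : 0 < c) (h : x * m = c) (h' : x * n = c) : m = n := by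
  have hx : x ≠ 0 := by rintro rfl; simp at h; linarith
  exact_mod_cast mul_left_cancel₀ hx (h.trans h'.symm)

lemma leg_sign (p : ↥dendroidX) (n : ℤ) (hy : |p.1.2| < 1) (h : p.1.1 * n = 1 - |p.1.2|) :
    (0 < n → 0 ≤ p.1.2 ∧ 0 ≤ p.1.1) ∧ (n < 0 → p.1.2 ≤ 0 ∧ p.1.1 ≤ 0) := by
  have hc : 0 < 1 - |p.1.2| := by linarith
  rcases dend_mem p with h0 | ⟨m, hm, hm1, hm2, hm3⟩
  · rw [h0] at h; simp at h; linarith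
  · obtain rfl := leg_unique hc h hm1
    refine ⟨fun hn => ⟨hm2 hn, ?_⟩, fun hn => ⟨hm3 hn, ?_⟩⟩
    · have : (0 : ℝ) < n := by exact_mod_cast hn
      by_contra hh
      push Not at hh
      nlinarith
    · have : (n : ℝ) < 0 := by exact_mod_cast hn
      by_contra hh
      push Not at hh
      nlinarith

lemma legPart_eq (e : ℝ) (he : e < 1) (n : ℤ) : legPart e n =
    {p : ↥dendroidX | |p.1.2| < e} ∩ {p | |1 - |p.1.2| - p.1.1 * n| < |p.1.1| / 2} := by
  ext p
  simp only [legPart, mem_ofPred_eq, mem_inter_iff]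
  refine and_congr_right fun hy => ?_
  constructor
  · intro h
    rw [h]
    have : p.1.1 ≠ 0 := by intro h0; rw [h0] at h; simp at h; linarith
    simpa using this
  · intro h
    rcases dend_mem p with h0 | ⟨m, hm, hm1, -⟩
    · rw [h0] at h; simp at h; exact absurd h (not_lt.2 (abs_nonneg _))
    · rw [← hm1, ← mul_sub, abs_mul] at h
      have hx : 0 < |p.1.1| := by
        by_contra hh
        have : |p.1.1| = 0 := le_antisymm (not_lt.1 hh) (abs_nonneg _)
        rw [this] at h; simp at h
      have h2 : |(m : ℝ) - n| < 1 := by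
        by_contra hh
        push Not at hh
        nlinarith
      have h3 : |m - n| < 1 := by exact_mod_cast h2
      have h4 : m = n := by
        have := Int.abs_lt_one_iff.1 h3
        omega
      rw [← h4, hm1]

lemma isOpen_legPart (e : ℝ) (he : e < 1) (n : ℤ) : IsOpen (legPart e n) := by
  rw [legPart_eq e he]
  exact (isOpen_lt (by fun_prop) (by fun_prop)).inter (isOpen_lt (by fun_prop) (by fun_prop))

lemma isOpen_legCompl (e : ℝ) (n : ℤ) :
    IsOpen ({p : ↥dendroidX | |p.1.2| ≠ e} \ legPart e n) := by
  have : ({p : ↥dendroidX | |p.1.2| ≠ e} \ legPart e n) =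
      {p | e < |p.1.2|} ∪ ({p | |p.1.2| < e} ∩ {p : ↥dendroidX | p.1.1 * (n : ℝ) ≠ 1 - |p.1.2|}) := by
    ext p
    simp only [legPart, mem_sdiff, mem_union, mem_inter_iff, mem_ofPred_eq, not_and]
    constructor
    · rintro ⟨h1, h2⟩
      rcases lt_or_gt_of_ne h1 with h | h
      · exact Or.inr ⟨h, h2 h⟩
      · exact Or.inl h
    · rintro (h | ⟨h, h'⟩)
      · exact ⟨h.ne', fun h2 => absurd h2 h.not_gt⟩
      · exact ⟨h.ne, fun _ => h'⟩
  rw [this]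
  exact (isOpen_lt (by fun_prop) (by fun_prop)).union
    ((isOpen_lt (by fun_prop) (by fun_prop)).inter (isOpen_ne_fun (by fun_prop) (by fun_prop)))

lemma isOpen_up {X : Type*} [TopologicalSpace X] (U : Set X) (hU : IsOpen U) :
    IsOpen {F : Sc X | F.1 ⊆ U} :=
  ⟨{F | F ⊆ U}, TopologicalSpace.isOpen_generateFrom_of_mem (Or.inl ⟨U, hU, rfl⟩), rfl⟩

lemma isOpen_hit {X : Type*} [TopologicalSpace X] (U : Set X) (hU : IsOpen U) :
    IsOpen {F : Sc X | (F.1 ∩ U).Nonempty} :=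
  ⟨{F | (F ∩ U).Nonempty}, TopologicalSpace.isOpen_generateFrom_of_mem (Or.inr ⟨U, hU, rfl⟩), rfl⟩

lemma mem_legSet (S : Set ↥dendroidX) (e : ℝ) (n : ℤ) :
    n ∈ legSet S e ↔ (S ∩ legPart e n).Nonempty := Iff.rfl

lemma exists_conn_nhd (t : unitInterval) (V : Set unitInterval) (hV : V ∈ 𝓝 t) :
    ∃ W ∈ 𝓝 t, IsPreconnected W ∧ W ⊆ V := by
  obtain ⟨d, hd, h⟩ := Metric.mem_nhds_iff.1 hV
  refine ⟨_, Metric.ball_mem_nhds t hd, ?_, h⟩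
  rw [← Topology.IsInducing.subtypeVal.isPreconnected_image]
  have : (Subtype.val '' Metric.ball t d) = Icc (0 : ℝ) 1 ∩ Metric.ball (t : ℝ) d := by
    ext x
    constructor
    · rintro ⟨y, hy, rfl⟩
      exact ⟨y.2, hy⟩
    · rintro ⟨hx, hy⟩
      exact ⟨⟨x, hx⟩, hy, rfl⟩
  rw [this]
  exact ((convex_Icc 0 1).inter (convex_ball _ _)).isPreconnected

/-- Local constancy of the set of legs hit. -/
lemma legSet_const (f : unitInterval → Sc ↥dendroidX) (hf : Continuous f) (t : unitInterval)
    (e : ℝ) (he1 : e < 1) (ht : ∀ p ∈ (f t).1, |p.1.2| ≠ e) :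
    ∀ᶠ s in 𝓝 t, legSet (f s).1 e = legSet (f t).1 e := by
  have hO : IsOpen {p : ↥dendroidX | |p.1.2| ≠ e} := isOpen_ne_fun (by fun_prop) (by fun_prop)
  have hW : f ⁻¹' {F | F.1 ⊆ {p : ↥dendroidX | |p.1.2| ≠ e}} ∈ 𝓝 t :=
    ((isOpen_up _ hO).preimage hf).mem_nhds ht
  obtain ⟨W, hWn, hWc, hWs⟩ := exists_conn_nhd t _ hW
  filter_upwards [hWn] with s hs
  have htW := mem_of_mem_nhds hWn
  ext n
  rw [mem_legSet, mem_legSet]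
  have h1 := (isOpen_hit _ (isOpen_legPart e he1 n)).preimage hf
  have h2 := (isOpen_up _ (isOpen_legCompl e n)).preimage hf
  have hdis : Disjoint (f ⁻¹' {F | (F.1 ∩ legPart e n).Nonempty})
      (f ⁻¹' {F | F.1 ⊆ {p : ↥dendroidX | |p.1.2| ≠ e} \ legPart e n}) := by
    rw [Set.disjoint_left]
    rintro a ⟨p, hp, hp'⟩ h
    exact (h hp).2 hp'
  have hcov : W ⊆ (f ⁻¹' {F | (F.1 ∩ legPart e n).Nonempty}) ∪
      (f ⁻¹' {F | F.1 ⊆ {p : ↥dendroidX | |p.1.2| ≠ e} \ legPart e n}) := by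
    intro a ha
    by_cases hh : ((f a).1 ∩ legPart e n).Nonempty
    · exact Or.inl hh
    · exact Or.inr fun p hp => ⟨hWs ha hp, fun hp' => hh ⟨p, hp, hp'⟩⟩
  constructor
  · intro h
    exact hWc.subset_left_of_subset_union h1 h2 hdis hcov ⟨s, hs, h⟩ htW
  · intro h
    exact hWc.subset_left_of_subset_union h1 h2 hdis hcov ⟨t, htW, h⟩ hs

lemma limit_mem_closed {X : Type*} [TopologicalSpace X] {S : Set X} {x : X} (h : IsNCS S x)
    {T C : Set X} (hT : T.Infinite) (hTS : T ⊆ S) (hC : IsClosed C) (hTC : T ⊆ C) : x ∈ C := by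
  by_contra hx
  exact hT ((h.2.2.2.2.2.2 Cᶜ hC.isOpen_compl hx).subset fun y hy => ⟨hTS hy, fun h => h (hTC hy)⟩)

lemma infinite_pts (S : Set ↥dendroidX) (e : ℝ) (he : e < 1) (P : Set ℤ)
    (hP : (P ∩ legSet S e).Infinite) :
    {p : ↥dendroidX | p ∈ S ∧ ∃ n ∈ P, |p.1.2| < 1 ∧ p.1.1 * n = 1 - |p.1.2|}.Infinite := by
  intro hfin
  refine hP ((hfin.image fun p => round ((1 - |p.1.2|) / p.1.1)).subset ?_)
  rintro n ⟨hn, p, hp, hy, h⟩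
  refine ⟨p, ⟨hp, n, hn, by linarith, h⟩, ?_⟩
  have hx : p.1.1 ≠ 0 := by intro h0; rw [h0] at h; simp at h; linarith
  simp only [← h]
  rw [mul_div_cancel_left₀ _ hx, round_intCast]

lemma limit_eq {S : Set ↥dendroidX} {x : ↥dendroidX} (h : IsNCS S x) (e : ℝ) (he : e < 1)
    (hpos : ({n : ℤ | 0 < n} ∩ legSet S e).Infinite)
    (hneg : ({n : ℤ | n < 0} ∩ legSet S e).Infinite) : x.1.2 = 0 := by
  have h1 : x ∈ {p : ↥dendroidX | 0 ≤ p.1.2} :=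
    limit_mem_closed h (infinite_pts S e he _ hpos) (fun p hp => hp.1)
      (isClosed_le (by fun_prop) (by fun_prop))
      (by rintro p ⟨-, n, hn, hy, hh⟩; exact ((leg_sign p n hy hh).1 hn).1)
  have h2 : x ∈ {p : ↥dendroidX | p.1.2 ≤ 0} :=
    limit_mem_closed h (infinite_pts S e he _ hneg) (fun p hp => hp.1)
      (isClosed_le (by fun_prop) (by fun_prop))
      (by rintro p ⟨-, n, hn, hy, hh⟩; exact ((leg_sign p n hy hh).2 hn).1)
  exact le_antisymm h2 h1

lemma legSet_diff {S : Set ↥dendroidX} {x : ↥dendroidX} (h : IsNCS S x) (hx : x.1.2 = 0)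
    (e e' : ℝ) (he : e < 1) (he' : 0 < e') : (legSet S e \ legSet S e').Finite := by
  have hfin := h.2.2.2.2.2.2 {p : ↥dendroidX | |p.1.2| < e'}
    (isOpen_lt (by fun_prop) (by fun_prop)) (by simpa [hx] using he')
  refine (hfin.image fun p => round ((1 - |p.1.2|) / p.1.1)).subset ?_
  rintro n ⟨⟨p, hp, hy, hh⟩, hn⟩
  refine ⟨p, ⟨hp, fun hp' => hn ⟨p, hp, hp', hh⟩⟩, ?_⟩
  have hx : p.1.1 ≠ 0 := by intro h0; rw [h0] at hh; simp at hh; linarith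
  simp only [← hh]
  rw [mul_div_cancel_left₀ _ hx, round_intCast]

/-- Equality modulo finite sets. -/
def AE (P Q : Set ℤ) : Prop := (P \ Q).Finite ∧ (Q \ P).Finite

lemma AE.trans {P Q R : Set ℤ} (h : AE P Q) (h' : AE Q R) : AE P R :=
  ⟨(h.1.union h'.1).subset fun x hx => by
      by_cases hq : x ∈ Q
      · exact Or.inr ⟨hq, hx.2⟩
      · exact Or.inl ⟨hx.1, hq⟩,
   (h.2.union h'.2).subset fun x hx => by
      by_cases hq : x ∈ Q
      · exact Or.inl ⟨hq, hx.2⟩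
      · exact Or.inr ⟨hx.1, hq⟩⟩

lemma inf_inter {P D N : Set ℤ} {E : Set ℤ} (hE : E.Infinite) (hED : E ⊆ D) (hEP : E ⊆ P)
    (h : AE N D) : (P ∩ N).Infinite := by
  intro hfin
  refine hE ((hfin.union h.2).subset fun x hx => ?_)
  by_cases hn : x ∈ N
  · exact Or.inl ⟨hEP hx, hn⟩
  · exact Or.inr ⟨hED hx, hn⟩

lemma negInts_inf : {n : ℤ | n < 0}.Infinite := Set.Iio_infinite 0

lemma all_eps {A : Set ℤ} (hApos : A ⊆ {n : ℤ | 0 < n}) (hAinf : A.Infinite)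
    (S : Sc ↥dendroidX) (e e' : ℝ) (he0 : 0 < e) (he : e < 1) (he'0 : 0 < e') (he' : e' < 1)
    (h : AE (legSet S.1 e) (A ∪ {n : ℤ | n < 0})) :
    AE (legSet S.1 e') (A ∪ {n : ℤ | n < 0}) := by
  obtain ⟨x, hx⟩ := S.2
  have h0 := limit_eq hx e he (inf_inter hAinf subset_union_left hApos h)
    (inf_inter negInts_inf subset_union_right subset_rfl h)
  exact AE.trans ⟨legSet_diff hx h0 e' e he' he0, legSet_diff hx h0 e e' he he'0⟩ h

lemma exists_generic (S : Sc ↥dendroidX) :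
    ∃ e : ℝ, 0 < e ∧ e < 1 ∧ ∀ p ∈ S.1, |p.1.2| ≠ e := by
  obtain ⟨x, hx⟩ := S.2
  have hc : ((fun p : ↥dendroidX => |p.1.2|) '' S.1).Countable := hx.2.1.image _
  have hu : ¬ (Ioo (0 : ℝ) 1).Countable := by
    rw [← Cardinal.le_aleph0_iff_set_countable, Cardinal.mk_Ioo_real one_pos]
    exact not_le.2 Cardinal.aleph0_lt_continuum
  obtain ⟨e, he, he'⟩ := not_subset.1 fun hs => hu (hc.mono hs)
  exact ⟨e, he.1, he.2, fun p hp h => he' ⟨p, hp, h⟩⟩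

lemma xPt_mem (n : ℤ) (hn : n ≠ 0) : xPt n ∈ dendroidX := by
  rcases lt_or_gt_of_ne hn with h | h
  · exact Or.inr (mem_iUnion.2 ⟨⟨n, h⟩, right_mem_segment _ _ _⟩)
  · exact Or.inl (Or.inr (mem_iUnion.2 ⟨⟨n, h⟩, right_mem_segment _ _ _⟩))

lemma legSet_seqSet (A : Set ℤ) (hApos : A ⊆ {n : ℤ | 0 < n}) :
    legSet (seqSet A) (1 / 2) = A ∪ {n : ℤ | n < 0} := by
  ext n
  constructor
  · rintro ⟨p, hp | ⟨k, hk, hp⟩, hy, h⟩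
    · rw [hp] at h; simp [vPt] at h
    · rw [hp] at h
      have hk0 : k ≠ 0 := by
        rcases hk with hk | hk
        · exact (hApos hk).ne'
        · exact hk.ne
      have hk0' : (k : ℝ) ≠ 0 := by exact_mod_cast hk0
      simp only [xPt, abs_zero, sub_zero] at h
      field_simp at h
      have : n = k := by exact_mod_cast h
      rw [this]; exact hk
  · intro hn
    have hn0 : n ≠ 0 := by
      rcases hn with hk | hk
      · exact (hApos hk).ne'
      · exact (show n < 0 from hk).ne
    have hn0' : (n : ℝ) ≠ 0 := by exact_mod_cast hn0
    refine ⟨⟨xPt n, xPt_mem n hn0⟩, Or.inr ⟨n, hn, rfl⟩, ?_, ?_⟩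
    · simp [xPt]
    · simp [xPt, hn0']

/-- If `A` and `B` are infinite almost disjoint subsets of `ℤ⁺`, then there is no path
in `S_c(X)` between `S_A` and `S_B`, where `X` is the dendroid above. -/
theorem stmt_17 (A B : Set ℤ) (hApos : A ⊆ {n : ℤ | 0 < n}) (hBpos : B ⊆ {n : ℤ | 0 < n})
    (hAinf : A.Infinite) (hBinf : B.Infinite) (hAB : (A ∩ B).Finite)
    (SA SB : Sc ↥dendroidX) (hSA : SA.1 = seqSet A) (hSB : SB.1 = seqSet B) :
    ¬ ∃ f : unitInterval → Sc ↥dendroidX,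
        Continuous f ∧ f 0 = SA ∧ f 1 = SB := by
  rintro ⟨f, hf, h0, h1⟩
  let G : unitInterval → Prop := fun t => AE (legSet (f t).1 (1 / 2)) (A ∪ {n : ℤ | n < 0})
  have hG : IsLocallyConstant G := by
    rw [IsLocallyConstant.iff_eventually_eq]
    intro t
    obtain ⟨e, he0, he1, he⟩ := exists_generic (f t)
    filter_upwards [legSet_const f hf t e he1 he] with s hs
    have key : ∀ r, G r ↔ AE (legSet (f r).1 e) (A ∪ {n : ℤ | n < 0}) := fun r =>
      ⟨all_eps hApos hAinf _ _ _ (by norm_num) (by norm_num) he0 he1,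
       all_eps hApos hAinf _ _ _ he0 he1 (by norm_num) (by norm_num)⟩
    apply propext
    rw [key, key, hs]
  have hG0 : G 0 := by
    simp only [G, h0, hSA, legSet_seqSet A hApos]
    exact ⟨by simp, by simp⟩
  have hG1 : G 1 := by
    rw [← hG.apply_eq_of_preconnectedSpace 0 1]; exact hG0
  simp only [G, h1, hSB, legSet_seqSet B hBpos] at hG1
  refine hAinf ((hAB.union hG1.2).subset fun n hn => ?_)
  by_cases hnB : n ∈ B
  · exact Or.inl ⟨hn, hnB⟩
  · refine Or.inr ⟨Or.inl hn, ?_⟩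
    rintro (h | h)
    · exact hnB h
    · have h2 : 0 < n := hApos hn
      have h3 : n < 0 := h
      omega
end
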